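/- Let φ ∈ C^∞(ℝ^n_y × ℝ^n_ξ) be real-valued with |det ∂_y∂_ξ φ(y,ξ)| ≥ C₀ > 0 for all (y,ξ), and with every entry h of ∂_y∂_ξ φ satisfying |∂_y^α h| ≤ C_α and |∂_ξ^β h| ≤ C_β for all |α|, |β| ≤ 2n+1. Let a ∈ C^∞(ℝ^n_x × ℝ^n_ξ) satisfy |∂_x^α ∂_ξ^β a(x,ξ)| ≤ C_{αβ} for all multi-indices α, β (the class S⁰_{0,0}), and assume a(x,ξ) = 0 whenever ξ lies outside some compact set K. Then the operator Tu(x) = ∫_{ℝ^n}∫_{ℝ^n} e^{i(x·ξ + φ(y,ξ))} a(x,ξ) u(y) dy dξ, defined for Schwartz u, satisfies ‖Tu‖_{L²(ℝ^n)} ≤ C ‖u‖_{L²(ℝ^n)}, where C depends only on n, C₀, the phase constants, and finitely many of the constants C_{αβ}, and is independent of the compact set K. -/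

import Mathlib

open MeasureTheory Complex SchwartzMap
open scoped BigOperators ENNReal Real RealInnerProductSpace

noncomputable section

/-- The derivative of `g` along the direction `v`. -/
def dLine {W F : Type*} [NormedAddCommGroup W] [NormedSpace ℝ W]
    [NormedAddCommGroup F] [NormedSpace ℝ F] (v : W) (g : W → F) : W → F :=
  fun z => fderiv ℝ g z v

/-- The iterated partial derivative `∂^α` along the coordinate directions `dirs`,
with multiplicities given by the multi-index `α`. -/
def mderiv {n : ℕ} {W F : Type*} [NormedAddCommGroup W] [NormedSpace ℝ W]
    [NormedAddCommGroup F] [NormedSpace ℝ F]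
    (dirs : Fin n → W) (α : Fin n → ℕ) (g : W → F) : W → F :=
  ((List.ofFn fun i => (dLine (dirs i) (F := F))^[α i]).foldr (· ∘ ·) id) g

/-- The length `|α|` of a multi-index. -/
def mdeg {n : ℕ} (α : Fin n → ℕ) : ℕ := ∑ i, α i

/-- The first-factor coordinate directions in `ℝ^n × ℝ^n`. -/
def dX {n : ℕ} (i : Fin n) : EuclideanSpace ℝ (Fin n) × EuclideanSpace ℝ (Fin n) :=
  (EuclideanSpace.single i 1, 0)

/-- The second-factor coordinate directions in `ℝ^n × ℝ^n`. -/
def dY {n : ℕ} (j : Fin n) : EuclideanSpace ℝ (Fin n) × EuclideanSpace ℝ (Fin n) :=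
  (0, EuclideanSpace.single j 1)

/-- The entry `∂²φ/∂u_i∂v_j` of the mixed Hessian of a function of two `ℝ^n` variables. -/
def mixedHessXY {n : ℕ}
    (φ : EuclideanSpace ℝ (Fin n) × EuclideanSpace ℝ (Fin n) → ℝ) (i j : Fin n) :
    EuclideanSpace ℝ (Fin n) × EuclideanSpace ℝ (Fin n) → ℝ :=
  dLine (dX i) (dLine (dY j) φ)


universe u_a u_i


theorem cotlar_words {A : Type u_a} {ι : Type u_i} [NormedRing A] [StarRing A] [CStarRing A] [Fintype ι]
    (T : ι → A) (B : ℝ) (hB : 0 ≤ B)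
    (h1 : ∀ i, ∑ j, √‖star (T j) * T i‖ ≤ B)
    (h2 : ∀ i, ∑ j, √‖T j * star (T i)‖ ≤ B) (m : ℕ) :
    ∃ (κ : Type u_i) (_ : Fintype κ) (i : κ → ι) (Y : κ → A) (a b : κ → ℝ),
      (star (∑ j, T j) * ∑ j, T j) ^ (m + 1) = ∑ k, star (T (i k)) * Y k ∧
      (∀ k, ‖star (T (i k)) * Y k‖ ≤ a k) ∧ (∀ k, ‖Y k‖ ≤ b k) ∧
      ∑ k, √(a k * b k) ≤ (∑ j, B * √‖T j‖) * (B ^ 2) ^ m := by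
  induction m with
  | zero =>
    refine ⟨ι × ι, inferInstance, fun p => p.2, fun p => T p.1,
      fun p => ‖star (T p.2) * T p.1‖, fun p => ‖T p.1‖, ?_, fun _ => le_rfl, fun _ => le_rfl, ?_⟩
    · rw [zero_add, pow_one, star_sum, Finset.sum_mul_sum, Finset.sum_comm, Fintype.sum_prod_type]
    · rw [pow_zero, mul_one, Fintype.sum_prod_type]
      refine Finset.sum_le_sum fun j _ => ?_
      simp only [Real.sqrt_mul (norm_nonneg _)]
      rw [← Finset.sum_mul]
      exact mul_le_mul_of_nonneg_right (h1 j) (Real.sqrt_nonneg _)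
  | succ m ih =>
    obtain ⟨κ, _, i, Y, a, b, hP, ha, hb, hs⟩ := ih
    refine ⟨κ × ι × ι, inferInstance, fun p => p.2.2,
      fun p => T p.2.1 * (star (T (i p.1)) * Y p.1),
      fun p => ‖star (T p.2.2) * T p.2.1‖ * a p.1,
      fun p => ‖T p.2.1 * star (T (i p.1))‖ * b p.1, ?_, ?_, ?_, ?_⟩
    · rw [pow_succ', hP, star_sum, Finset.mul_sum, Fintype.sum_prod_type]
      refine Finset.sum_congr rfl fun k _ => ?_
      rw [Finset.sum_mul_sum, Finset.sum_comm, Finset.sum_mul, Fintype.sum_prod_type]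
      refine Finset.sum_congr rfl fun j _ => ?_
      rw [Finset.sum_mul]
      simp only [mul_assoc]
    · intro p
      beta_reduce
      rw [← mul_assoc]
      exact (norm_mul_le _ _).trans (mul_le_mul_of_nonneg_left (ha _) (norm_nonneg _))
    · intro p
      beta_reduce
      rw [← mul_assoc]
      exact (norm_mul_le _ _).trans (mul_le_mul_of_nonneg_left (hb _) (norm_nonneg _))
    · have key : ∀ k, ∑ p : ι × ι, √(‖star (T p.2) * T p.1‖ * a k *
          (‖T p.1 * star (T (i k))‖ * b k)) ≤ B ^ 2 * √(a k * b k) := by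
        intro k
        have ha0 : 0 ≤ a k := (norm_nonneg _).trans (ha k)
        have hb0 : 0 ≤ b k := (norm_nonneg _).trans (hb k)
        have : ∀ p : ι × ι, √(‖star (T p.2) * T p.1‖ * a k *
          (‖T p.1 * star (T (i k))‖ * b k)) = √‖star (T p.2) * T p.1‖ *
            (√‖T p.1 * star (T (i k))‖ * √(a k * b k)) := by
          intro p
          rw [← Real.sqrt_mul (norm_nonneg _), ← Real.sqrt_mul (norm_nonneg _)]
          congr 1; ring
        simp only [this, Fintype.sum_prod_type]
        calc _ = ∑ x, (∑ y, √‖star (T y) * T x‖) * (√‖T x * star (T (i k))‖ * √(a k * b k)) := by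
              simp only [Finset.sum_mul]
          _ ≤ ∑ x, B * (√‖T x * star (T (i k))‖ * √(a k * b k)) := by
              refine Finset.sum_le_sum fun j _ => mul_le_mul_of_nonneg_right (h1 j) (by positivity)
          _ = B * (∑ x, √‖T x * star (T (i k))‖) * √(a k * b k) := by
              rw [Finset.mul_sum, Finset.sum_mul]; simp only [mul_assoc]
          _ ≤ B * B * √(a k * b k) := by gcongr; exact h2 _
          _ = _ := by ring
      rw [Fintype.sum_prod_type]
      calc _ ≤ ∑ k, B ^ 2 * √(a k * b k) := Finset.sum_le_sum fun k _ => key k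
        _ = B ^ 2 * ∑ k, √(a k * b k) := by rw [Finset.mul_sum]
        _ ≤ B ^ 2 * ((∑ j, B * √‖T j‖) * (B ^ 2) ^ m) := by gcongr
        _ = _ := by ring

theorem cotlar_stein {A : Type u_a} {ι : Type u_i} [NormedRing A] [StarRing A] [CStarRing A] [Fintype ι]
    (T : ι → A) (B : ℝ) (hB : 0 ≤ B)
    (h1 : ∀ i, ∑ j, √‖star (T j) * T i‖ ≤ B)
    (h2 : ∀ i, ∑ j, √‖T j * star (T i)‖ ≤ B) : ‖∑ j, T j‖ ≤ B := by
  set S := ∑ j, T j with hS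
  have hT : ∀ i, ‖T i‖ ≤ ∑ j, ‖T j‖ := fun i =>
    Finset.single_le_sum (f := fun j => ‖T j‖) (fun j _ => norm_nonneg _) (Finset.mem_univ i)
  have bound : ∀ m : ℕ, ‖(star S * S) ^ (m + 1)‖ ≤
      (√(∑ j, ‖T j‖) * ∑ j, B * √‖T j‖) * (B ^ 2) ^ m := by
    intro m
    obtain ⟨κ, _, i, Y, a, b, hP, ha, hb, hs⟩ := cotlar_words T B hB h1 h2 m
    rw [hS, hP]
    refine (norm_sum_le _ _).trans ?_
    have : ∀ k, ‖star (T (i k)) * Y k‖ ≤ √(∑ j, ‖T j‖) * √(a k * b k) := by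
      intro k
      rw [← Real.sqrt_mul (Finset.sum_nonneg fun j _ => norm_nonneg _)]
      apply Real.le_sqrt_of_sq_le
      have hb' : ‖star (T (i k)) * Y k‖ ≤ (∑ j, ‖T j‖) * b k :=
        (norm_mul_le _ _).trans (mul_le_mul (by rw [norm_star]; exact hT _) (hb k)
          (norm_nonneg _) (Finset.sum_nonneg fun j _ => norm_nonneg _))
      have := mul_le_mul (ha k) hb' (norm_nonneg _) ((norm_nonneg _).trans (ha k))
      nlinarith
    refine (Finset.sum_le_sum fun k _ => this k).trans ?_
    rw [← Finset.mul_sum, mul_assoc]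
    gcongr
  set K := √(∑ j, ‖T j‖) * ∑ j, B * √‖T j‖
  have hsa : IsSelfAdjoint (star S * S) := IsSelfAdjoint.star_mul_self S
  have hn : ∀ k : ℕ, (‖S‖ ^ 2) ^ (2 ^ k) = ‖(star S * S) ^ (2 ^ k)‖ := by
    intro k
    have := congrArg NNReal.toReal (hsa.nnnorm_pow_two_pow k)
    simp only [coe_nnnorm, NNReal.coe_pow] at this
    rw [this, CStarRing.norm_star_mul_self]; ring
  by_contra! hlt
  have hS0 : 0 < ‖S‖ := hB.trans_lt hlt
  rcases hB.eq_or_lt with h0 | hB0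
  · have := bound 1
    rw [← h0] at this
    have h2 := hn 1
    norm_num at this h2
    rw [this] at h2
    norm_num at h2
    exact hS0.ne' (by simpa using h2)
  · have hr : 1 < ‖S‖ ^ 2 / B ^ 2 := by
      rw [one_lt_div (by positivity)]; gcongr
    obtain ⟨m, hm⟩ := pow_unbounded_of_one_lt (K / B ^ 2) hr
    have hm2 : m ≤ 2 ^ m := Nat.lt_two_pow_self.le
    have h3 := (hm.trans_le (pow_le_pow_right₀ hr.le hm2))
    obtain ⟨l, hl⟩ : ∃ l, 2 ^ m = l + 1 := ⟨2 ^ m - 1, by have := Nat.one_le_two_pow (n := m); omega⟩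
    have h4 := hn m
    have h5 := bound l
    rw [← hl, ← h4] at h5
    rw [div_pow, div_lt_div_iff₀ (by positivity) (by positivity)] at h3
    have : (‖S‖ ^ 2) ^ 2 ^ m * B ^ 2 ≤ K * (B ^ 2) ^ l * B ^ 2 := by gcongr
    rw [mul_assoc, ← pow_succ, ← hl] at this
    linarith


theorem hadamard_local {E : Type*} [NormedAddCommGroup E] [NormedSpace ℝ E] [CompleteSpace E]
    (F : E → E) (F' : E → E ≃L[ℝ] E) (hF : ∀ y, HasFDerivAt F (F' y : E →L[ℝ] E) y) (M L : ℝ)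
    (hM0 : 0 < M) (hL0 : 0 < L) (hM : ∀ y v, ‖(F' y).symm v‖ ≤ M * ‖v‖)
    (hL : ∀ y z, ‖(F' y : E →L[ℝ] E) - F' z‖ ≤ L * ‖y - z‖) (r : ℝ) (hr : r = 1 / (2 * M * L))
    (y : E) :
    (∀ a ∈ Metric.closedBall y r, ∀ b ∈ Metric.closedBall y r, ‖a - b‖ ≤ 2 * M * ‖F a - F b‖) ∧
    (∀ s, 0 ≤ s → s ≤ r → ∀ q, ‖q - F y‖ ≤ s / (2 * M) → ∃ a, ‖a - y‖ ≤ s ∧ F a = q) := by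
  have hc0 : 0 ≤ 1 / (2 * M) := by positivity
  have happ : ApproximatesLinearOn F (F' y : E →L[ℝ] E) (Metric.closedBall y r)
      ⟨1 / (2 * M), hc0⟩ := by
    intro a ha b hb
    have h := (convex_closedBall y r).norm_image_sub_le_of_norm_hasFDerivWithin_le
      (f := fun x => F x - F' y x) (f' := fun x => (F' x : E →L[ℝ] E) - (F' y : E →L[ℝ] E))
      (C := 1 / (2 * M)) (x := b) (y := a)
      (fun x _ => ((hF x).sub ((F' y : E →L[ℝ] E).hasFDerivAt)).hasFDerivWithinAt) ?_ hb ha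
    · change _ ≤ 1 / (2 * M) * ‖a - b‖
      refine le_trans (le_of_eq ?_) h
      congr 1
      simp only [map_sub, ContinuousLinearEquiv.coe_coe]
      abel
    · intro x hx
      refine (hL x y).trans ?_
      rw [Metric.mem_closedBall, dist_eq_norm] at hx
      calc L * ‖x - y‖ ≤ L * r := by gcongr
        _ = _ := by rw [hr]; field_simp
  constructor
  · intro a ha b hb
    have h := happ a ha b hb
    have h2 := hM y (F' y (a - b))
    rw [ContinuousLinearEquiv.symm_apply_apply] at h2
    have h3 : ‖F' y (a - b)‖ ≤ ‖F a - F b‖ + 1 / (2 * M) * ‖a - b‖ := by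
      have := norm_sub_norm_le ((F' y : E →L[ℝ] E) (a - b)) (F a - F b)
      rw [norm_sub_rev _ (F a - F b)] at this
      have h' : ‖F a - F b - (F' y : E →L[ℝ] E) (a - b)‖ ≤ 1 / (2 * M) * ‖a - b‖ := h
      have e : (F' y : E →L[ℝ] E) (a - b) = F' y (a - b) := rfl
      rw [e] at h' this
      linarith
    have h4 : M * ‖F' y (a - b)‖ ≤ M * ‖F a - F b‖ + 1 / 2 * ‖a - b‖ := by
      calc _ ≤ M * (‖F a - F b‖ + 1 / (2 * M) * ‖a - b‖) := by gcongr
        _ = _ := by field_simp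
    linarith
  · intro s hs hsr q hq
    let N : (F' y : E →L[ℝ] E).NonlinearRightInverse :=
      { toFun := (F' y).symm
        nnnorm := ⟨M, hM0.le⟩
        bound' := fun v => hM y v
        right_inv' := fun v => (F' y).apply_symm_apply v }
    have := happ.surjOn_closedBall_of_nonlinearRightInverse N hs
      (Metric.closedBall_subset_closedBall hsr)
    obtain ⟨a, ha, haq⟩ := this (show q ∈ _ by
      rw [Metric.mem_closedBall, dist_eq_norm]
      refine hq.trans (le_of_eq ?_)
      change _ = (M⁻¹ - 1 / (2 * M)) * s
      field_simp; ring)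
    exact ⟨a, by simpa [dist_eq_norm] using ha, haq⟩

theorem hadamard_bound {E : Type*} [NormedAddCommGroup E] [NormedSpace ℝ E] [CompleteSpace E]
    (F : E → E) (F' : E → E ≃L[ℝ] E) (hF : ∀ y, HasFDerivAt F (F' y : E →L[ℝ] E) y) (M L Λ : ℝ)
    (hM0 : 0 < M) (hL0 : 0 < L) (hΛ0 : 0 < Λ) (hM : ∀ y v, ‖(F' y).symm v‖ ≤ M * ‖v‖)
    (hL : ∀ y z, ‖(F' y : E →L[ℝ] E) - F' z‖ ≤ L * ‖y - z‖)
    (hΛ : ∀ y z, ‖F y - F z‖ ≤ Λ * ‖y - z‖) (y₀ y₁ : E) :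
    ‖y₁ - y₀‖ ≤ 2 * M * ‖F y₁ - F y₀‖ := by
  obtain ⟨r, hr⟩ : ∃ r : ℝ, r = 1 / (2 * M * L) := ⟨_, rfl⟩
  have hr0 : 0 < r := by rw [hr]; positivity
  have hinj := fun y => (hadamard_local F F' hF M L hM0 hL0 hM hL r hr y).1
  have hsurj := fun y => (hadamard_local F F' hF M L hM0 hL0 hM hL r hr y).2
  obtain ⟨m, hm⟩ := exists_nat_gt (4 * M * (Λ * ‖y₁ - y₀‖) / r)
  have hm0 : (0 : ℝ) < m := lt_of_le_of_lt (by positivity) hm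
  let P : E → Prop := fun p => ∃ c : ℕ → E, c 0 = y₀ ∧ c m = p ∧
    (∀ i ≤ m, F (c i) = F y₀ + ((i : ℝ) / m) • (F p - F y₀)) ∧
    (∀ i < m, ‖c (i + 1) - c i‖ ≤ r / 2)
  have step : ∀ p p', ‖p' - p‖ ≤ r / 4 → Λ * ‖p' - p‖ ≤ r / (8 * M) →
      ‖p' - y₀‖ ≤ ‖y₁ - y₀‖ → P p → P p' := by
    rintro p p' h1 h2 h3 ⟨c, c0, cm, hc, hstep⟩
    have hex : ∀ i, ∃ a, i ≤ m → ‖a - c i‖ ≤ r / 4 ∧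
        F a = F y₀ + ((i : ℝ) / m) • (F p' - F y₀) := by
      intro i
      by_cases hi : i ≤ m
      · obtain ⟨a, ha⟩ := hsurj (c i) (r / 4) (by positivity) (by linarith)
          (F y₀ + ((i : ℝ) / m) • (F p' - F y₀)) (by
            rw [hc i hi]
            have : F y₀ + ((i : ℝ) / m) • (F p' - F y₀) - (F y₀ + ((i : ℝ) / m) • (F p - F y₀))
              = ((i : ℝ) / m) • (F p' - F p) := by module
            rw [this, norm_smul]
            have hi1 : ‖(i : ℝ) / m‖ ≤ 1 := by
              rw [Real.norm_of_nonneg (by positivity), div_le_one hm0]; exact_mod_cast hi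
            calc _ ≤ 1 * (Λ * ‖p' - p‖) := by gcongr; exact hΛ _ _
              _ ≤ 1 * (r / (8 * M)) := by gcongr
              _ = _ := by field_simp; norm_num)
        exact ⟨a, fun _ => ha⟩
      · exact ⟨0, fun h => absurd h hi⟩
    choose c' hc' using hex
    refine ⟨c', ?_, ?_, fun i hi => (hc' i hi).2, ?_⟩
    · obtain ⟨ha, hb⟩ := hc' 0 (Nat.zero_le _)
      rw [c0] at ha
      have := hinj y₀ (c' 0) (by rw [Metric.mem_closedBall, dist_eq_norm]; linarith) y₀
        (Metric.mem_closedBall_self hr0.le)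
      rw [hb] at this
      simpa [sub_eq_zero] using this
    · obtain ⟨ha, hb⟩ := hc' m le_rfl
      rw [cm] at ha
      have := hinj p (c' m) (by rw [Metric.mem_closedBall, dist_eq_norm]; linarith) p'
        (by rw [Metric.mem_closedBall, dist_eq_norm]; linarith)
      rw [hb, div_self hm0.ne'] at this
      simpa [sub_eq_zero] using this
    · intro i hi
      obtain ⟨ha, hb⟩ := hc' i hi.le
      obtain ⟨ha', hb'⟩ := hc' (i + 1) hi
      have h5 := hstep i hi
      have := hinj (c i) (c' (i + 1)) (by
        rw [Metric.mem_closedBall, dist_eq_norm]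
        have := norm_add_le (c' (i + 1) - c (i + 1)) (c (i + 1) - c i)
        rw [sub_add_sub_cancel] at this
        linarith) (c' i) (by rw [Metric.mem_closedBall, dist_eq_norm]; linarith)
      rw [hb, hb'] at this
      refine this.trans ?_
      have e : F y₀ + (((i + 1 : ℕ) : ℝ) / m) • (F p' - F y₀) -
          (F y₀ + ((i : ℝ) / m) • (F p' - F y₀)) = ((1 : ℝ) / m) • (F p' - F y₀) := by
        push_cast; rw [add_div]; module
      rw [e, norm_smul, Real.norm_of_nonneg (by positivity)]
      have h6 : ‖F p' - F y₀‖ ≤ Λ * ‖y₁ - y₀‖ := (hΛ _ _).trans (by gcongr)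
      rw [div_lt_iff₀ hr0] at hm
      calc 2 * M * (1 / m * ‖F p' - F y₀‖) ≤ 2 * M * (1 / m * (Λ * ‖y₁ - y₀‖)) := by gcongr
        _ = (4 * M * (Λ * ‖y₁ - y₀‖)) / (2 * m) := by field_simp; ring
        _ ≤ (m * r) / (2 * m) := by gcongr
        _ = r / 2 := by field_simp
  have hP0 : P y₀ := ⟨fun _ => y₀, rfl, rfl, by simp, fun i _ => by simp; positivity⟩
  obtain ⟨K, hK⟩ := exists_nat_gt (‖y₁ - y₀‖ / (r / 4) + Λ * ‖y₁ - y₀‖ / (r / (8 * M)))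
  have hK0 : (0 : ℝ) < K := lt_of_le_of_lt (by positivity) hK
  have hPl : ∀ l : ℕ, l ≤ K → P (y₀ + ((l : ℝ) / K) • (y₁ - y₀)) := by
    intro l
    induction l with
    | zero => intro _; simpa using hP0
    | succ l ih =>
      intro hl
      have e : y₀ + (((l + 1 : ℕ) : ℝ) / K) • (y₁ - y₀) - (y₀ + ((l : ℝ) / K) • (y₁ - y₀)) =
          ((1 : ℝ) / K) • (y₁ - y₀) := by push_cast; rw [add_div]; module
      have n1 : ‖((1 : ℝ) / K) • (y₁ - y₀)‖ = ‖y₁ - y₀‖ / K := by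
        rw [norm_smul, Real.norm_of_nonneg (by positivity)]; ring
      refine step _ _ ?_ ?_ ?_ (ih (by omega))
      · rw [e, n1, div_le_iff₀ hK0, mul_comm, ← div_le_iff₀ (by positivity)]
        have : 0 ≤ Λ * ‖y₁ - y₀‖ / (r / (8 * M)) := by positivity
        linarith
      · rw [e, n1, ← mul_div_assoc, div_le_iff₀ hK0, mul_comm (r / (8 * M)),
          ← div_le_iff₀ (by positivity)]
        have : 0 ≤ ‖y₁ - y₀‖ / (r / 4) := by positivity
        linarith
      · rw [add_sub_cancel_left, norm_smul, Real.norm_of_nonneg (by positivity)]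
        refine mul_le_of_le_one_left (norm_nonneg _) ?_
        rw [div_le_one hK0]; exact_mod_cast hl
  have hP1 : P y₁ := by
    have := hPl K le_rfl
    rwa [div_self hK0.ne', one_smul, add_sub_cancel] at this
  obtain ⟨c, c0, cm, hc, hstep⟩ := hP1
  have hd : ∀ i < m, ‖c (i + 1) - c i‖ ≤ 2 * M * (1 / m * ‖F y₁ - F y₀‖) := by
    intro i hi
    have := hinj (c i) (c (i + 1)) (by
      rw [Metric.mem_closedBall, dist_eq_norm]; linarith [hstep i hi]) (c i)
      (Metric.mem_closedBall_self hr0.le)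
    rw [hc i hi.le, hc (i + 1) hi] at this
    refine this.trans (le_of_eq ?_)
    have e : F y₀ + (((i + 1 : ℕ) : ℝ) / m) • (F y₁ - F y₀) -
          (F y₀ + ((i : ℝ) / m) • (F y₁ - F y₀)) = ((1 : ℝ) / m) • (F y₁ - F y₀) := by
        push_cast; rw [add_div]; module
    rw [e, norm_smul, Real.norm_of_nonneg (by positivity)]
  calc ‖y₁ - y₀‖ = ‖∑ i ∈ Finset.range m, (c (i + 1) - c i)‖ := by
        rw [Finset.sum_range_sub, c0, cm]
    _ ≤ ∑ i ∈ Finset.range m, 2 * M * (1 / m * ‖F y₁ - F y₀‖) :=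
        norm_sum_le_of_le _ fun i hi => hd i (Finset.mem_range.1 hi)
    _ = 2 * M * ‖F y₁ - F y₀‖ := by
        rw [Finset.sum_const, Finset.card_range, nsmul_eq_mul]; field_simp


section NonStat

variable {E : Type*} [NormedAddCommGroup E] [NormedSpace ℝ E]

/-- Bounds on iterated line derivatives of order at most `k` on `U`. -/
def Bd (v : E) (U : Set E) : ℕ → ℝ → (E → ℂ) → Prop
  | 0, M, f => ∀ x ∈ U, ‖f x‖ ≤ M
  | k + 1, M, f => (∀ x ∈ U, ‖f x‖ ≤ M) ∧ Bd v U k M (dLine v f)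

theorem Bd.zero {v : E} {U : Set E} {k : ℕ} {M : ℝ} {f : E → ℂ} (h : Bd v U k M f) :
    ∀ x ∈ U, ‖f x‖ ≤ M := by
  cases k with
  | zero => exact h
  | succ k => exact h.1

theorem Bd.mono_const {v : E} {U : Set E} {k : ℕ} {M M' : ℝ} (hM : M ≤ M') :
    ∀ {f : E → ℂ}, Bd v U k M f → Bd v U k M' f := by
  induction k with
  | zero => intro f h x hx; exact (h x hx).trans hM
  | succ k ih => intro f h; exact ⟨fun x hx => (h.1 x hx).trans hM, ih h.2⟩

theorem Bd.pred {v : E} {U : Set E} {k : ℕ} {M : ℝ} :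
    ∀ {f : E → ℂ}, Bd v U (k + 1) M f → Bd v U k M f := by
  induction k with
  | zero => intro f h; exact h.1
  | succ k ih => intro f h; exact ⟨h.1, ih h.2⟩

theorem Bd.mono_set {v : E} {U V : Set E} {k : ℕ} {M : ℝ} (hV : V ⊆ U) :
    ∀ {f : E → ℂ}, Bd v U k M f → Bd v V k M f := by
  induction k with
  | zero => intro f h x hx; exact h x (hV hx)
  | succ k ih => intro f h; exact ⟨fun x hx => h.1 x (hV hx), ih h.2⟩

theorem Bd.of_iterate {v : E} {U : Set E} {k : ℕ} {M : ℝ} :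
    ∀ {f : E → ℂ}, (∀ j ≤ k, ∀ x ∈ U, ‖(dLine v)^[j] f x‖ ≤ M) → Bd v U k M f := by
  induction k with
  | zero => intro f h; exact h 0 le_rfl
  | succ k ih =>
    intro f h
    exact ⟨h 0 (Nat.zero_le _), ih fun j hj x hx => by
      have := h (j + 1) (by omega) x hx
      rwa [Function.iterate_succ_apply] at this⟩

theorem dLine_eqOn {v : E} {U : Set E} (hU : IsOpen U) {f g : E → ℂ} (h : Set.EqOn f g U) :
    Set.EqOn (dLine v f) (dLine v g) U := by
  intro x hx
  unfold dLine
  rw [(h.eventuallyEq_of_mem (hU.mem_nhds hx)).fderiv_eq]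

theorem Bd.congr {v : E} {U : Set E} (hU : IsOpen U) {k : ℕ} {M : ℝ} :
    ∀ {f g : E → ℂ}, Set.EqOn f g U → Bd v U k M f → Bd v U k M g := by
  induction k with
  | zero => intro f g hfg h x hx; rw [← hfg hx]; exact h x hx
  | succ k ih =>
    intro f g hfg h
    exact ⟨fun x hx => by rw [← hfg hx]; exact h.1 x hx, ih (dLine_eqOn hU hfg) h.2⟩

theorem contDiffOn_dLine {v : E} {U : Set E} (hU : IsOpen U) {f : E → ℂ}
    (hf : ContDiffOn ℝ (⊤ : ℕ∞) f U) : ContDiffOn ℝ (⊤ : ℕ∞) (dLine v f) U :=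
  ContDiffOn.clm_apply (hf.fderiv_of_isOpen hU (by simp)) contDiffOn_const

theorem contDiff_dLine {W F : Type*} [NormedAddCommGroup W] [NormedSpace ℝ W]
    [NormedAddCommGroup F] [NormedSpace ℝ F] {v : W} {f : W → F}
    (hf : ContDiff ℝ (⊤ : ℕ∞) f) : ContDiff ℝ (⊤ : ℕ∞) (dLine v f) :=
  ContDiff.clm_apply (hf.fderiv_right (by simp)) contDiff_const

theorem dAt {U : Set E} (hU : IsOpen U) {f : E → ℂ}
    (hf : ContDiffOn ℝ (⊤ : ℕ∞) f U) {x : E} (hx : x ∈ U) : DifferentiableAt ℝ f x :=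
  (hf.differentiableOn (by simp)).differentiableAt (hU.mem_nhds hx)

theorem Bd.add {v : E} {U : Set E} (hU : IsOpen U) {k : ℕ} {M M' : ℝ} :
    ∀ {f g : E → ℂ}, ContDiffOn ℝ (⊤ : ℕ∞) f U → ContDiffOn ℝ (⊤ : ℕ∞) g U →
    Bd v U k M f → Bd v U k M' g → Bd v U k (M + M') (fun x => f x + g x) := by
  induction k with
  | zero =>
    intro f g _ _ h h' x hx
    exact (norm_add_le _ _).trans (add_le_add (h x hx) (h' x hx))
  | succ k ih =>
    intro f g hf hg h h'
    refine ⟨fun x hx => (norm_add_le _ _).trans (add_le_add (h.1 x hx) (h'.1 x hx)), ?_⟩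
    refine Bd.congr hU ?_ (ih (contDiffOn_dLine hU hf) (contDiffOn_dLine hU hg) h.2 h'.2)
    intro x hx
    simp only [dLine]
    rw [fderiv_fun_add (dAt hU hf hx) (dAt hU hg hx)]; rfl

theorem Bd.mul {v : E} {U : Set E} (hU : IsOpen U) {k : ℕ} {M M' : ℝ} (hM : 0 ≤ M)
    (hM' : 0 ≤ M') :
    ∀ {f g : E → ℂ}, ContDiffOn ℝ (⊤ : ℕ∞) f U → ContDiffOn ℝ (⊤ : ℕ∞) g U →
    Bd v U k M f → Bd v U k M' g → Bd v U k (2 ^ k * (M * M')) (fun x => f x * g x) := by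
  induction k with
  | zero =>
    intro f g _ _ h h' x hx
    rw [norm_mul, pow_zero, one_mul]
    exact mul_le_mul (h x hx) (h' x hx) (norm_nonneg _) hM
  | succ k ih =>
    intro f g hf hg h h'
    constructor
    · intro x hx
      rw [norm_mul]
      refine (mul_le_mul (h.1 x hx) (h'.1 x hx) (norm_nonneg _) hM).trans ?_
      exact le_mul_of_one_le_left (by positivity) (one_le_pow₀ (by norm_num))
    · have h1 := ih (contDiffOn_dLine (v := v) hU hf) hg h.2 h'.pred
      have h2 := ih hf (contDiffOn_dLine (v := v) hU hg) h.pred h'.2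
      have h3 := Bd.add hU ((contDiffOn_dLine (v := v) hU hf).mul hg)
        (hf.mul (contDiffOn_dLine (v := v) hU hg)) h1 h2
      have e : 2 ^ k * (M * M') + 2 ^ k * (M * M') = 2 ^ (k + 1) * (M * M') := by ring
      rw [e] at h3
      refine Bd.congr hU ?_ h3
      intro x hx
      simp only [dLine]
      rw [fderiv_fun_mul (dAt hU hf hx) (dAt hU hg hx)]
      simp; ring

theorem Bd.inv (c Q : ℝ) (hc : 0 < c) (hQ : 0 ≤ Q) (k : ℕ) : ∃ C, 0 ≤ C ∧
    ∀ (v : E) (U : Set E), IsOpen U → ∀ q : E → ℂ, ContDiffOn ℝ (⊤ : ℕ∞) q U →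
      (∀ x ∈ U, c ≤ ‖q x‖) → Bd v U k Q q → Bd v U k C (fun x => (q x)⁻¹) := by
  have h0 : ∀ (U : Set E) (q : E → ℂ), (∀ x ∈ U, c ≤ ‖q x‖) →
      ∀ x ∈ U, ‖(q x)⁻¹‖ ≤ c⁻¹ := by
    intro U q hq x hx
    rw [norm_inv]
    exact inv_anti₀ hc (hq x hx)
  induction k with
  | zero => exact ⟨c⁻¹, by positivity, fun v U _ q _ hq _ => h0 U q hq⟩
  | succ k ih =>
    obtain ⟨C, hC, ih⟩ := ih
    refine ⟨c⁻¹ + 2 ^ k * (Q * (2 ^ k * (C * C))), by positivity, ?_⟩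
    intro v U hU q hq hqc hB
    have hne : ∀ x ∈ U, q x ≠ 0 := fun x hx h => by
      have := hqc x hx; rw [h, norm_zero] at this; linarith
    have hi : ContDiffOn ℝ (⊤ : ℕ∞) (fun x => (q x)⁻¹) U := hq.inv hne
    constructor
    · intro x hx
      exact (h0 U q hqc x hx).trans (le_add_of_nonneg_right (by positivity))
    · have h1 := ih v U hU q hq hqc hB.pred
      have h2 := Bd.mul hU hC hC hi hi h1 h1
      have hneg : Bd v U k Q (fun x => dLine v q x * (-1 : ℂ)) := by
        have gen : ∀ (k : ℕ) (f : E → ℂ), Bd v U k Q f → Bd v U k Q (fun x => f x * (-1 : ℂ)) := by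
          intro k
          induction k with
          | zero => intro f h x hx; simpa using h x hx
          | succ k ih =>
            intro f h
            refine ⟨fun x hx => by simpa using h.1 x hx, ?_⟩
            convert ih _ h.2 using 1
            ext x
            simp [dLine]
        exact gen k _ hB.2
      have h3 := Bd.mul hU hQ (by positivity) ((contDiffOn_dLine (v := v) hU hq).mul contDiffOn_const)
        (hi.mul hi) hneg h2
      refine Bd.congr hU ?_ (h3.mono_const (le_add_of_nonneg_left (by positivity)))
      intro x hx
      have hd := ((hasFDerivAt_inv' (𝕜 := ℝ) (hne x hx)).comp x (dAt hU hq hx).hasFDerivAt).fderiv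
      simp only [dLine]
      rw [show (fun x => (q x)⁻¹) = Inv.inv ∘ q from rfl, hd]
      simp
      field_simp

variable [MeasurableSpace E] [BorelSpace E] [FiniteDimensional ℝ E] (μ : Measure E)
  [μ.IsAddHaarMeasure]

theorem nonstat (c Q : ℝ) (hc : 0 < c) (hQ : 0 ≤ Q) (N : ℕ) : ∃ C, 0 ≤ C ∧
    ∀ (v : E) (U S : Set E), IsOpen U → S ⊆ U → IsCompact S →
      ∀ (D : E → ℝ) (q w : E → ℂ) (l W : ℝ), 0 < l → 0 ≤ W →
      ContDiff ℝ (⊤ : ℕ∞) D → ContDiff ℝ (⊤ : ℕ∞) q → ContDiff ℝ (⊤ : ℕ∞) w →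
      (∀ x, ((dLine v D x : ℝ) : ℂ) = l * q x) →
      (∀ x ∈ U, c ≤ ‖q x‖) → Bd v U N Q q → Bd v U N W w → tsupport w ⊆ S →
      ‖∫ x, w x * Complex.exp (Complex.I * (D x : ℂ)) ∂μ‖ ≤ C * W * l⁻¹ ^ N * μ.real S := by
  induction N with
  | zero =>
    refine ⟨1, zero_le_one, ?_⟩
    intro v U S hU hSU hS D q w l W hl hW hD hq hw hDq hqc hBq hBw hsupp
    have h1 : ∫ x, w x * Complex.exp (Complex.I * (D x : ℂ)) ∂μ =
        ∫ x in S, w x * Complex.exp (Complex.I * (D x : ℂ)) ∂μ := by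
      rw [setIntegral_eq_integral_of_forall_compl_eq_zero]
      intro x hx
      rw [image_eq_zero_of_notMem_tsupport (fun h => hx (hsupp h)), zero_mul]
    rw [h1, pow_zero, mul_one, one_mul]
    refine norm_setIntegral_le_of_norm_le_const hS.measure_lt_top ?_
    intro x hx
    rw [norm_mul, mul_comm Complex.I, Complex.norm_exp_ofReal_mul_I, mul_one]
    exact hBw x (hSU hx)
  | succ N ih =>
    obtain ⟨C, hC, ih⟩ := ih
    obtain ⟨C', hC', hinv⟩ := Bd.inv (E := E) c Q hc hQ (N + 1)
    refine ⟨C * (2 ^ (N + 1) * C'), by positivity, ?_⟩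
    intro v U S hU hSU hS D q w l W hl hW hD hq hw hDq hqc hBq hBw hsupp
    have hne : ∀ x ∈ U, q x ≠ 0 := fun x hx h => by
      have := hqc x hx; rw [h, norm_zero] at this; linarith
    set f : E → ℂ := fun x => w x * (q x)⁻¹ with hf
    have hfs : tsupport f ⊆ tsupport w := closure_mono (Function.support_mul_subset_left _ _)
    have hfC : ContDiff ℝ (⊤ : ℕ∞) f := by
      rw [contDiff_iff_contDiffAt]
      intro x
      by_cases hx : x ∈ U
      · exact hw.contDiffAt.mul (hq.contDiffAt.inv (hne x hx))
      · have : f =ᶠ[nhds x] fun _ => 0 :=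
          notMem_tsupport_iff_eventuallyEq.1 fun h => hx (hSU (hsupp (hfs h)))
        exact contDiffAt_const.congr_of_eventuallyEq this
    have hBf : Bd v U (N + 1) (2 ^ (N + 1) * (W * C')) f :=
      Bd.mul hU hW hC' hw.contDiffOn (hq.contDiffOn.inv hne) hBw
        (hinv v U hU q hq.contDiffOn hqc hBq)
    have hcw : HasCompactSupport w := HasCompactSupport.of_support_subset_isCompact hS
      ((subset_tsupport w).trans hsupp)
    have hcf : HasCompactSupport f := HasCompactSupport.of_support_subset_isCompact hS
      ((subset_tsupport f).trans (hfs.trans hsupp))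
    have hds : tsupport (dLine v f) ⊆ tsupport f := by
      refine closure_minimal ?_ (isClosed_tsupport f)
      intro x hx
      by_contra h
      apply hx
      have : f =ᶠ[nhds x] fun _ => 0 := notMem_tsupport_iff_eventuallyEq.1 h
      simp [dLine, this.fderiv_eq]
    have hcdf : HasCompactSupport (dLine v f) := HasCompactSupport.of_support_subset_isCompact hS
      ((subset_tsupport _).trans (hds.trans (hfs.trans hsupp)))
    have hdfC : ContDiff ℝ (⊤ : ℕ∞) (dLine v f) := contDiff_dLine hfC
    have key := ih v U S hU hSU hS D q (dLine v f) l (2 ^ (N + 1) * (W * C')) hl (by positivity)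
      hD hq hdfC hDq hqc hBq.pred hBf.2 (hds.trans (hfs.trans hsupp))
    set g : E → ℂ := fun x => Complex.exp (Complex.I * (D x : ℂ)) with hg
    have hDC : ContDiff ℝ (⊤ : ℕ∞) (fun x => (D x : ℂ)) := Complex.ofRealCLM.contDiff.comp hD
    have hgC : ContDiff ℝ (⊤ : ℕ∞) g := (contDiff_const.mul hDC).cexp
    have hg' : ∀ x, fderiv ℝ g x v = Complex.I * l * q x * g x := by
      intro x
      have h1 : HasFDerivAt D (fderiv ℝ D x) x :=
        (hD.differentiable (by simp) x).hasFDerivAt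
      have h2 := ((Complex.ofRealCLM.hasFDerivAt.comp x h1).const_mul Complex.I).cexp
      have h3 : HasFDerivAt g _ x := h2
      rw [h3.fderiv]
      have := hDq x
      simp only [dLine] at this
      simp [this, hg]
      ring
    have ibp := integral_mul_fderiv_eq_neg_fderiv_mul_of_integrable (μ := μ) (f := f) (g := g)
      (v := v) ?_ ?_ ?_ (fun x _ => hfC.differentiable (by simp) x)
      (fun x _ => hgC.differentiable (by simp) x)
    · have e : ∀ x, f x * fderiv ℝ g x v = (Complex.I * l) * (w x * g x) := by
        intro x
        rw [hg', hf]
        by_cases hx : x ∈ tsupport w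
        · have := hne x (hSU (hsupp hx))
          field_simp
        · simp [image_eq_zero_of_notMem_tsupport hx]
      simp only [e] at ibp
      rw [integral_const_mul] at ibp
      have e2 : ‖∫ x, w x * g x ∂μ‖ = l⁻¹ * ‖∫ x, dLine v f x * g x ∂μ‖ := by
        have := congrArg norm ibp
        rw [norm_mul, norm_neg, norm_mul, Complex.norm_I, one_mul, Complex.norm_real,
          Real.norm_of_nonneg hl.le] at this
        rw [show ∫ x, dLine v f x * g x ∂μ = ∫ x, fderiv ℝ f x v * g x ∂μ from rfl, ← this]
        field_simp
      rw [e2]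
      calc l⁻¹ * ‖∫ x, dLine v f x * g x ∂μ‖ ≤
          l⁻¹ * (C * (2 ^ (N + 1) * (W * C')) * l⁻¹ ^ N * μ.real S) := by gcongr
        _ = _ := by ring
    · exact (hdfC.continuous.mul hgC.continuous).integrable_of_hasCompactSupport hcdf.mul_right
    · refine (hfC.continuous.mul ?_).integrable_of_hasCompactSupport hcf.mul_right
      exact (contDiff_dLine (v := v) hgC).continuous
    · exact (hfC.continuous.mul hgC.continuous).integrable_of_hasCompactSupport hcf.mul_right

end NonStat


section Phase

theorem norm_le_sum_coord {n : ℕ} (v : EuclideanSpace ℝ (Fin n)) : ‖v‖ ≤ ∑ i, |v i| := by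
  rw [EuclideanSpace.norm_eq]
  refine Real.sqrt_le_iff.2 ⟨Finset.sum_nonneg fun i _ => abs_nonneg _, ?_⟩
  simp only [Real.norm_eq_abs]
  exact Finset.sum_sq_le_sq_sum_of_nonneg fun i _ => abs_nonneg _

theorem norm_le_card_mul {n : ℕ} (v : EuclideanSpace ℝ (Fin n)) (c : ℝ) (h : ∀ i, |v i| ≤ c) :
    ‖v‖ ≤ n * c := by
  refine (norm_le_sum_coord v).trans ((Finset.sum_le_sum fun i _ => h i).trans ?_)
  simp

theorem coord_le_norm {n : ℕ} (v : EuclideanSpace ℝ (Fin n)) (i : Fin n) : |v i| ≤ ‖v‖ :=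
  PiLp.norm_apply_le v i

theorem sum_single_eq {n : ℕ} (v : EuclideanSpace ℝ (Fin n)) :
    v = ∑ i, v i • EuclideanSpace.single i (1 : ℝ) := by
  ext j
  simp [Finset.sum_apply, Pi.single_apply]

theorem opnorm_le_of_coord {n : ℕ} {G : Type*} [NormedAddCommGroup G] [NormedSpace ℝ G]
    (T : EuclideanSpace ℝ (Fin n) →L[ℝ] G) (c : ℝ)
    (h : ∀ l, ‖T (EuclideanSpace.single l 1)‖ ≤ c) : ‖T‖ ≤ n * c := by
  rcases Nat.eq_zero_or_pos n with rfl | hn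
  · have : T = 0 := by ext v; rw [Subsingleton.elim v 0]; simp
    simp [this]
  have hc : 0 ≤ c := (norm_nonneg _).trans (h ⟨0, hn⟩)
  refine T.opNorm_le_bound (by positivity) fun v => ?_
  conv_lhs => rw [sum_single_eq v, map_sum]
  refine (norm_sum_le_of_le _ (n := fun _ => ‖v‖ * c) fun i _ => ?_).trans ?_
  · rw [map_smul, norm_smul]
    exact mul_le_mul (coord_le_norm v i) (h i) (norm_nonneg _) (norm_nonneg _)
  · simp; linarith

theorem mvt_coord {n : ℕ} {G : Type*} [NormedAddCommGroup G] [NormedSpace ℝ G]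
    (g : EuclideanSpace ℝ (Fin n) → G) (hg : Differentiable ℝ g)
    (c : ℝ) (h : ∀ l z, ‖dLine (EuclideanSpace.single l 1) g z‖ ≤ c)
    (y z : EuclideanSpace ℝ (Fin n)) : ‖g y - g z‖ ≤ n * c * ‖y - z‖ :=
  convex_univ.norm_image_sub_le_of_norm_fderiv_le (𝕜 := ℝ) (fun x _ => hg x)
    (fun x _ => opnorm_le_of_coord _ c fun l => h l x) (Set.mem_univ z) (Set.mem_univ y)

theorem hadamard_fd {E : Type*} [NormedAddCommGroup E] [NormedSpace ℝ E] [FiniteDimensional ℝ E]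
    (F : E → E) (hF : Differentiable ℝ F) (M L Λ : ℝ)
    (hM0 : 0 < M) (hL0 : 0 < L) (hΛ0 : 0 < Λ) (hM : ∀ y v, ‖v‖ ≤ M * ‖fderiv ℝ F y v‖)
    (hL : ∀ y z, ‖fderiv ℝ F y - fderiv ℝ F z‖ ≤ L * ‖y - z‖)
    (hΛ : ∀ y, ‖fderiv ℝ F y‖ ≤ Λ) (y₀ y₁ : E) :
    ‖y₁ - y₀‖ ≤ 2 * M * ‖F y₁ - F y₀‖ := by
  have : CompleteSpace E := FiniteDimensional.complete ℝ E
  have hinj : ∀ y, Function.Injective (fderiv ℝ F y : E →ₗ[ℝ] E) := by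
    intro y
    rw [injective_iff_map_eq_zero]
    intro a ha
    have h1 := hM y a
    have h2 : fderiv ℝ F y a = 0 := ha
    rw [h2, norm_zero, mul_zero] at h1
    exact norm_le_zero_iff.1 h1
  let F' : E → E ≃L[ℝ] E := fun y =>
    (LinearEquiv.ofInjectiveEndo _ (hinj y)).toContinuousLinearEquiv
  have hF' : ∀ y, (F' y : E →L[ℝ] E) = fderiv ℝ F y := by
    intro y; ext v; rfl
  refine hadamard_bound F F' (fun y => by rw [hF']; exact (hF y).hasFDerivAt) M L Λ hM0 hL0 hΛ0
    ?_ ?_ ?_ y₀ y₁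
  · intro y v
    have := hM y ((F' y).symm v)
    rw [← hF'] at this
    simpa using this
  · intro y z; rw [hF', hF']; exact hL y z
  · intro y z
    exact convex_univ.norm_image_sub_le_of_norm_fderiv_le (𝕜 := ℝ) (fun x _ => hF x)
      (fun x _ => hΛ x) (Set.mem_univ z) (Set.mem_univ y)

theorem matrix_lower (n : ℕ) (C₀ Q : ℝ) (hC₀ : 0 < C₀) : ∃ M, 0 < M ∧
    ∀ A : Matrix (Fin n) (Fin n) ℝ, (∀ i j, |A i j| ≤ Q) → C₀ ≤ |A.det| →
      ∀ v w : EuclideanSpace ℝ (Fin n), (∀ i, w i = ∑ j, A i j * v j) → ‖v‖ ≤ M * ‖w‖ := by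
  set R := max Q 1 with hR
  have hR0 : 0 ≤ R := le_max_of_le_right zero_le_one
  refine ⟨n * (C₀⁻¹ * (n * (n.factorial * R ^ n))) + 1, by positivity, ?_⟩
  intro A hA hdet v w hw
  have hw' : WithLp.ofLp w = A.mulVec (WithLp.ofLp v) := by
    ext i; rw [hw i]; rfl
  have hadj : ∀ i j, |A.adjugate i j| ≤ n.factorial * R ^ n := by
    intro i j
    rw [Matrix.adjugate_apply]
    have := Matrix.det_le (A := A.updateRow j (Pi.single i 1)) (abv := IsAbsoluteValue.toAbsoluteValue (abs : ℝ → ℝ)) (x := R) (by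
      intro a b
      change |_| ≤ _
      rw [Matrix.updateRow_apply]
      split_ifs with h
      · by_cases hb : b = i
        · subst hb; simp [hR]
        · simp [hb, hR0]
      · exact (hA a b).trans (le_max_left _ _))
    simpa using this
  have hv : ∀ i, |v i| ≤ C₀⁻¹ * (n * (n.factorial * R ^ n)) * ‖w‖ := by
    intro i
    have h1 : A.det • WithLp.ofLp v = A.adjugate.mulVec (WithLp.ofLp w) := by
      rw [hw', Matrix.mulVec_mulVec, Matrix.adjugate_mul, Matrix.smul_mulVec, Matrix.one_mulVec]
    have h2 : A.det * v i = ∑ j, A.adjugate i j * w j := congrFun h1 i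
    have h3 : |A.det| * |v i| ≤ n * (n.factorial * R ^ n) * ‖w‖ := by
      rw [← abs_mul, h2]
      refine (Finset.abs_sum_le_sum_abs _ _).trans ?_
      calc _ ≤ ∑ j : Fin n, (n.factorial * R ^ n) * ‖w‖ := by
            refine Finset.sum_le_sum fun j _ => ?_
            rw [abs_mul]
            exact mul_le_mul (hadj i j) (coord_le_norm w j) (abs_nonneg _) (by positivity)
        _ = _ := by simp; ring
    have h4 : C₀ * |v i| ≤ n * (n.factorial * R ^ n) * ‖w‖ :=
      (mul_le_mul_of_nonneg_right hdet (abs_nonneg _)).trans h3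
    rw [mul_assoc, ← div_eq_inv_mul, le_div_iff₀ hC₀]
    linarith
  have := norm_le_card_mul v _ hv
  have hw0 := norm_nonneg w
  linarith

theorem dLine_comm {W F : Type*} [NormedAddCommGroup W] [NormedSpace ℝ W]
    [NormedAddCommGroup F] [NormedSpace ℝ F] (u v : W) {f : W → F}
    (hf : ContDiff ℝ (⊤ : ℕ∞) f) : dLine u (dLine v f) = dLine v (dLine u f) := by
  ext z
  have hd : DifferentiableAt ℝ (fderiv ℝ f) z :=
    (hf.fderiv_right (m := (⊤ : ℕ∞)) (by simp)).differentiable (by simp) z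
  have hs : IsSymmSndFDerivAt ℝ f z := hf.contDiffAt.isSymmSndFDerivAt (by
    rw [minSmoothness_of_isRCLikeNormedField]
    exact WithTop.coe_le_coe.2 (le_top : (2 : ℕ∞) ≤ ⊤))
  have e : ∀ a b : W, dLine a (dLine b f) z = fderiv ℝ (fderiv ℝ f) z a b := by
    intro a b
    change fderiv ℝ (fun y => fderiv ℝ f y b) z a = _
    rw [fderiv_clm_apply hd (differentiableAt_const b)]
    simp
  rw [e, e]
  exact hs u v

theorem contDiff_dLine_iterate {W F : Type*} [NormedAddCommGroup W] [NormedSpace ℝ W]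
    [NormedAddCommGroup F] [NormedSpace ℝ F] {v : W} (m : ℕ) : ∀ {f : W → F},
    ContDiff ℝ (⊤ : ℕ∞) f → ContDiff ℝ (⊤ : ℕ∞) ((dLine v)^[m] f) := by
  induction m with
  | zero => intro f hf; exact hf
  | succ m ih => intro f hf; rw [Function.iterate_succ_apply]; exact ih (contDiff_dLine hf)

theorem dLine_iterate_comm {W F : Type*} [NormedAddCommGroup W] [NormedSpace ℝ W]
    [NormedAddCommGroup F] [NormedSpace ℝ F] (u v : W) (m : ℕ) : ∀ {f : W → F},
    ContDiff ℝ (⊤ : ℕ∞) f → dLine u ((dLine v)^[m] f) = (dLine v)^[m] (dLine u f) := by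
  induction m with
  | zero => intro f hf; rfl
  | succ m ih =>
    intro f hf
    rw [Function.iterate_succ_apply, Function.iterate_succ_apply, ih (contDiff_dLine hf),
      dLine_comm u v hf]

variable {n : ℕ} {F : Type*} [NormedAddCommGroup F] [NormedSpace ℝ F]

theorem dLine_sliceX {f : EuclideanSpace ℝ (Fin n) × EuclideanSpace ℝ (Fin n) → F}
    (hf : ContDiff ℝ (⊤ : ℕ∞) f) (r : Fin n) (y : EuclideanSpace ℝ (Fin n)) :
    dLine (EuclideanSpace.single r 1) (fun x => f (x, y)) = fun x => dLine (dX r) f (x, y) := by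
  ext x
  have h0 : HasFDerivAt (fun x : EuclideanSpace ℝ (Fin n) => (x, y))
    ((ContinuousLinearMap.id ℝ (EuclideanSpace ℝ (Fin n))).prod 0) x :=
    (hasFDerivAt_id x).prodMk (hasFDerivAt_const y x)
  have h1 := HasFDerivAt.comp x (hf.differentiable (by simp) (x, y)).hasFDerivAt h0
  have h2 : HasFDerivAt (fun x => f (x, y)) _ x := h1
  change fderiv ℝ (fun x => f (x, y)) x _ = _
  rw [h2.fderiv]
  simp [dX, dLine]

theorem dLine_sliceY {f : EuclideanSpace ℝ (Fin n) × EuclideanSpace ℝ (Fin n) → F}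
    (hf : ContDiff ℝ (⊤ : ℕ∞) f) (r : Fin n) (x : EuclideanSpace ℝ (Fin n)) :
    dLine (EuclideanSpace.single r 1) (fun y => f (x, y)) = fun y => dLine (dY r) f (x, y) := by
  ext y
  have h0 : HasFDerivAt (fun y : EuclideanSpace ℝ (Fin n) => (x, y))
    ((0 : EuclideanSpace ℝ (Fin n) →L[ℝ] EuclideanSpace ℝ (Fin n)).prod
      (ContinuousLinearMap.id ℝ (EuclideanSpace ℝ (Fin n)))) y :=
    (hasFDerivAt_const x y).prodMk (hasFDerivAt_id y)
  have h1 := HasFDerivAt.comp y (hf.differentiable (by simp) (x, y)).hasFDerivAt h0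
  have h2 : HasFDerivAt (fun y => f (x, y)) _ y := h1
  change fderiv ℝ (fun y => f (x, y)) y _ = _
  rw [h2.fderiv]
  simp [dY, dLine]

theorem iter_sliceX (r : Fin n) (y : EuclideanSpace ℝ (Fin n)) (m : ℕ) :
    ∀ {f : EuclideanSpace ℝ (Fin n) × EuclideanSpace ℝ (Fin n) → F}, ContDiff ℝ (⊤ : ℕ∞) f →
    (dLine (EuclideanSpace.single r 1))^[m] (fun x => f (x, y)) =
      fun x => (dLine (dX r))^[m] f (x, y) := by
  induction m with
  | zero => intro f hf; rfl
  | succ m ih =>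
    intro f hf
    rw [Function.iterate_succ_apply, dLine_sliceX hf, ih (contDiff_dLine hf)]
    rfl

theorem slice_smoothX {f : EuclideanSpace ℝ (Fin n) × EuclideanSpace ℝ (Fin n) → F}
    (hf : ContDiff ℝ (⊤ : ℕ∞) f) (y : EuclideanSpace ℝ (Fin n)) :
    ContDiff ℝ (⊤ : ℕ∞) (fun x => f (x, y)) := hf.comp (contDiff_id.prodMk contDiff_const)

theorem slice_smoothY {f : EuclideanSpace ℝ (Fin n) × EuclideanSpace ℝ (Fin n) → F}
    (hf : ContDiff ℝ (⊤ : ℕ∞) f) (x : EuclideanSpace ℝ (Fin n)) :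
    ContDiff ℝ (⊤ : ℕ∞) (fun y => f (x, y)) := hf.comp (contDiff_const.prodMk contDiff_id)

/-- Hypotheses on the phase. -/
structure PhaseHyp (n : ℕ) (C₀ Q : ℝ)
    (ψ : EuclideanSpace ℝ (Fin n) × EuclideanSpace ℝ (Fin n) → ℝ) : Prop where
  smooth : ContDiff ℝ (⊤ : ℕ∞) ψ
  det : ∀ z, C₀ ≤ |Matrix.det (Matrix.of fun i j => mixedHessXY ψ i j z)|
  bX : ∀ i l r m, m ≤ 2 * n + 1 → ∀ z, |(dLine (dX r))^[m] (mixedHessXY ψ i l) z| ≤ Q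
  bY : ∀ i l r m, m ≤ 2 * n + 1 → ∀ z, |(dLine (dY r))^[m] (mixedHessXY ψ i l) z| ≤ Q

/-- Differences in the second variable of functions whose `dY`-derivatives are bounded. -/
theorem diffY_le {f : EuclideanSpace ℝ (Fin n) × EuclideanSpace ℝ (Fin n) → ℝ}
    (hf : ContDiff ℝ (⊤ : ℕ∞) f) (c : ℝ) (h : ∀ l z, |dLine (dY l) f z| ≤ c)
    (x y y' : EuclideanSpace ℝ (Fin n)) : |f (x, y') - f (x, y)| ≤ n * c * ‖y' - y‖ := by
  refine mvt_coord (fun y => f (x, y)) ((slice_smoothY hf x).differentiable (by simp)) c ?_ y' y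
  intro l z
  rw [dLine_sliceY hf]
  exact h l (x, z)

theorem PhaseHyp.lower (n : ℕ) (C₀ Q : ℝ) (hC₀ : 0 < C₀) (hQ : 0 < Q) : ∃ M, 0 < M ∧
    ∀ ψ, PhaseHyp n C₀ Q ψ → ∀ x y y' : EuclideanSpace ℝ (Fin n), ∀ b : ℝ, 0 ≤ b →
      (∀ i, |dLine (dX i) ψ (x, y') - dLine (dX i) ψ (x, y)| ≤ b) → ‖y' - y‖ ≤ M * b := by
  obtain ⟨M, hM, hml⟩ := matrix_lower n C₀ Q hC₀
  refine ⟨2 * M * (n + 1), by positivity, ?_⟩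
  intro ψ hψ x y y' b hb0 hb
  let f : EuclideanSpace ℝ (Fin n) → EuclideanSpace ℝ (Fin n) :=
    fun y => WithLp.toLp 2 (fun i => dLine (dX i) ψ (x, y))
  have hcomp : ∀ i, ContDiff ℝ (⊤ : ℕ∞) (fun y => dLine (dX i) ψ (x, y)) := fun i =>
    slice_smoothY (contDiff_dLine hψ.smooth) x
  have hfC : ContDiff ℝ (⊤ : ℕ∞) f := contDiff_euclidean.2 hcomp
  have hfd : Differentiable ℝ f := hfC.differentiable (by simp)
  have hmh : ∀ i l, dLine (dY l) (dLine (dX i) ψ) = mixedHessXY ψ i l := fun i l =>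
    dLine_comm _ _ hψ.smooth
  have hder : ∀ y l i, (fderiv ℝ f y (EuclideanSpace.single l 1)) i = mixedHessXY ψ i l (x, y) := by
    intro y l i
    have h1 := ((EuclideanSpace.proj (𝕜 := ℝ) i).hasFDerivAt.comp y (hfd y).hasFDerivAt)
    have h2 : HasFDerivAt (fun y => dLine (dX i) ψ (x, y)) _ y := h1
    have h3 : (fderiv ℝ f y (EuclideanSpace.single l 1)) i =
        dLine (EuclideanSpace.single l 1) (fun y => dLine (dX i) ψ (x, y)) y := by
      simp only [dLine] at h2 ⊢
      rw [h2.fderiv]; rfl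
    rw [h3, dLine_sliceY (contDiff_dLine hψ.smooth), hmh]
  have hder' : ∀ y v i, (fderiv ℝ f y v) i = ∑ l, mixedHessXY ψ i l (x, y) * v l := by
    intro y v i
    conv_lhs => rw [sum_single_eq v, map_sum]
    simp [hder, mul_comm]
  have hsm : ∀ i l, ContDiff ℝ (⊤ : ℕ∞) (mixedHessXY ψ i l) := fun i l =>
    contDiff_dLine (contDiff_dLine hψ.smooth)
  have h0 : ∀ i l z, |mixedHessXY ψ i l z| ≤ Q := fun i l z => hψ.bX i l i 0 (by omega) z
  have key := hadamard_fd f hfd M (n * (n * (n * Q)) + 1) (n * (n * Q) + 1) hM (by positivity)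
    (by positivity) ?_ ?_ ?_ y y'
  · refine key.trans ?_
    have hb' : ‖f y' - f y‖ ≤ n * b := norm_le_card_mul _ b hb
    have hn : ‖f y' - f y‖ ≤ (n + 1) * b := by linarith
    calc _ ≤ 2 * M * ((n + 1) * b) := by gcongr
      _ = _ := by ring
  · intro y v
    exact hml (Matrix.of fun i j => mixedHessXY ψ i j (x, y)) (fun i j => h0 i j _)
      (hψ.det (x, y)) v _ (hder' y v)
  · intro y z
    have : ‖fderiv ℝ f y - fderiv ℝ f z‖ ≤ n * (n * (n * Q * ‖y - z‖)) := by
      refine opnorm_le_of_coord _ _ fun l => norm_le_card_mul _ _ fun i => ?_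
      have e : ((fderiv ℝ f y - fderiv ℝ f z) (EuclideanSpace.single l 1)) i =
        mixedHessXY ψ i l (x, y) - mixedHessXY ψ i l (x, z) := by rw [← hder, ← hder]; rfl
      rw [e]
      exact diffY_le (hsm i l) Q (fun r z => hψ.bY i l r 1 (by omega) z) x z y
    have h2 := norm_nonneg (y - z)
    linarith
  · intro y
    have : ‖fderiv ℝ f y‖ ≤ n * (n * Q) := by
      refine opnorm_le_of_coord _ _ fun l => norm_le_card_mul _ _ fun i => ?_
      rw [hder]
      exact h0 i l _
    linarith

end Phase


section Osc

variable {n : ℕ}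

theorem iter_diff (r : Fin n) (y y' : EuclideanSpace ℝ (Fin n)) (m : ℕ) :
    ∀ {f : EuclideanSpace ℝ (Fin n) × EuclideanSpace ℝ (Fin n) → ℝ}, ContDiff ℝ (⊤ : ℕ∞) f →
    (dLine (EuclideanSpace.single r 1))^[m] (fun x => f (x, y') - f (x, y)) =
      fun x => (dLine (dX r))^[m] f (x, y') - (dLine (dX r))^[m] f (x, y) := by
  induction m with
  | zero => intro f hf; rfl
  | succ m ih =>
    intro f hf
    have e : dLine (EuclideanSpace.single r 1) (fun x => f (x, y') - f (x, y)) =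
        fun x => dLine (dX r) f (x, y') - dLine (dX r) f (x, y) := by
      ext x
      have h1 := congrFun (dLine_sliceX hf r y') x
      have h2 := congrFun (dLine_sliceX hf r y) x
      rw [← h1, ← h2]
      change fderiv ℝ (fun x => f (x, y') - f (x, y)) x _ = _
      rw [fderiv_fun_sub ((slice_smoothX hf y').differentiable (by simp) x)
        ((slice_smoothX hf y).differentiable (by simp) x)]
      rfl
    rw [Function.iterate_succ_apply, e, ih (contDiff_dLine hf)]
    rfl

theorem iter_ofReal {E : Type*} [NormedAddCommGroup E] [NormedSpace ℝ E] (v : E) (c : ℂ) (m : ℕ) :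
    ∀ {f : E → ℝ}, ContDiff ℝ (⊤ : ℕ∞) f →
    (dLine v)^[m] (fun x => c * (f x : ℂ)) = fun x => c * (((dLine v)^[m] f x : ℝ) : ℂ) := by
  induction m with
  | zero => intro f hf; rfl
  | succ m ih =>
    intro f hf
    have e : dLine v (fun x => c * (f x : ℂ)) = fun x => c * ((dLine v f x : ℝ) : ℂ) := by
      ext x
      have h1 := (hf.differentiable (by simp) x).hasFDerivAt
      have h2 : HasFDerivAt (fun x => ((f x : ℝ) : ℂ)) (Complex.ofRealCLM.comp (fderiv ℝ f x)) x :=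
        Complex.ofRealCLM.hasFDerivAt.comp x h1
      change fderiv ℝ (fun x => c * (f x : ℂ)) x v = _
      rw [(h2.const_mul c).fderiv]
      simp [dLine]
    rw [Function.iterate_succ_apply, e, ih (contDiff_dLine hf)]
    rfl

theorem osc (n : ℕ) (C₀ Q : ℝ) (hC₀ : 0 < C₀) (hQ : 0 < Q) : ∃ ρ C : ℝ, 0 < ρ ∧ 0 ≤ C ∧
    ∀ ψ, PhaseHyp n C₀ Q ψ → ∀ (x₀ : EuclideanSpace ℝ (Fin n)) (w : EuclideanSpace ℝ (Fin n) → ℂ)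
      (W : ℝ), 0 ≤ W → ContDiff ℝ (⊤ : ℕ∞) w → tsupport w ⊆ Metric.closedBall x₀ ρ →
      (∀ x, ‖w x‖ ≤ W) → (∀ r, Bd (EuclideanSpace.single r (1 : ℝ)) Set.univ (2 * n + 1) W w) →
      ∀ ξ ξ' : EuclideanSpace ℝ (Fin n),
      ‖∫ x, w x * Complex.exp (Complex.I * ((ψ (x, ξ') - ψ (x, ξ) : ℝ) : ℂ))‖ ≤
        C * W * ((1 + ‖ξ' - ξ‖)⁻¹) ^ (2 * n + 1) := by
  obtain ⟨M, hM, hlow⟩ := PhaseHyp.lower n C₀ Q hC₀ hQ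
  set ρ : ℝ := 1 / (8 * M * (n * (n * Q) + 1)) with hρ
  have hρ0 : 0 < ρ := by positivity
  have hc : 0 < 1 / (4 * M) := by positivity
  obtain ⟨C, hC, hns⟩ := nonstat (E := EuclideanSpace ℝ (Fin n)) volume (1 / (4 * M)) (n * Q) hc
    (by positivity) (2 * n + 1)
  set V : ℝ := (volume : Measure (EuclideanSpace ℝ (Fin n))).real (Metric.closedBall 0 ρ) with hV
  have hV0 : 0 ≤ V := measureReal_nonneg
  refine ⟨ρ, 2 ^ (2 * n + 1) * (C + 1) * V, hρ0, by positivity, ?_⟩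
  intro ψ hψ x₀ w W hW hw hsupp hwW hBd ξ ξ'
  have hVx : (volume : Measure (EuclideanSpace ℝ (Fin n))).real (Metric.closedBall x₀ ρ) = V := by
    rw [hV, Measure.real, Measure.real, Measure.addHaar_closedBall_center]
  set l : ℝ := ‖ξ' - ξ‖ with hl
  have hl0 : 0 ≤ l := norm_nonneg _
  rcases lt_or_ge l 1 with h1 | h1
  · have e : ∫ x, w x * Complex.exp (Complex.I * ((ψ (x, ξ') - ψ (x, ξ) : ℝ) : ℂ)) =
        ∫ x in Metric.closedBall x₀ ρ,
          w x * Complex.exp (Complex.I * ((ψ (x, ξ') - ψ (x, ξ) : ℝ) : ℂ)) := by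
      rw [setIntegral_eq_integral_of_forall_compl_eq_zero]
      intro x hx
      rw [image_eq_zero_of_notMem_tsupport fun h => hx (hsupp h), zero_mul]
    rw [e]
    have h2 := norm_setIntegral_le_of_norm_le_const (μ := volume)
      (f := fun x => w x * Complex.exp (Complex.I * ((ψ (x, ξ') - ψ (x, ξ) : ℝ) : ℂ)))
      (s := Metric.closedBall x₀ ρ) (C := W)
      (isCompact_closedBall x₀ ρ).measure_lt_top (fun x _ => by
        rw [norm_mul, mul_comm Complex.I, Complex.norm_exp_ofReal_mul_I, mul_one]
        exact hwW x)
    refine h2.trans ?_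
    rw [hVx]
    have h3 : (1 : ℝ) ≤ 2 ^ (2 * n + 1) * ((1 + l)⁻¹) ^ (2 * n + 1) := by
      rw [← mul_pow]
      refine one_le_pow₀ ?_
      rw [← div_eq_mul_inv, le_div_iff₀ (by positivity)]
      linarith
    calc W * V ≤ (W * V) * (2 ^ (2 * n + 1) * ((1 + l)⁻¹) ^ (2 * n + 1)) :=
          le_mul_of_one_le_right (by positivity) h3
      _ ≤ (C + 1) * ((W * V) * (2 ^ (2 * n + 1) * ((1 + l)⁻¹) ^ (2 * n + 1))) :=
          le_mul_of_one_le_left (by positivity) (by linarith)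
      _ = _ := by ring
  · have hl1 : 0 < l := by linarith
    obtain ⟨i, hi⟩ : ∃ i, l / (2 * M) <
        |dLine (dX i) ψ (x₀, ξ') - dLine (dX i) ψ (x₀, ξ)| := by
      by_contra hcon
      push Not at hcon
      have := hlow ψ hψ x₀ ξ ξ' (l / (2 * M)) (by positivity) hcon
      rw [← hl] at this
      have e : M * (l / (2 * M)) = l / 2 := by field_simp
      rw [e] at this
      linarith
    have hψi : ContDiff ℝ (⊤ : ℕ∞) (dLine (dX i) ψ) := contDiff_dLine hψ.smooth
    set g : EuclideanSpace ℝ (Fin n) → ℝ :=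
      fun x => dLine (dX i) ψ (x, ξ') - dLine (dX i) ψ (x, ξ) with hg
    have hgs : ContDiff ℝ (⊤ : ℕ∞) g := (slice_smoothX hψi ξ').sub (slice_smoothX hψi ξ)
    have hit : ∀ r m, m ≤ 2 * n + 1 → ∀ x,
        |(dLine (EuclideanSpace.single r 1))^[m] g x| ≤ n * Q * l := by
      intro r m hm x
      rw [hg, iter_diff r ξ ξ' m hψi]
      refine diffY_le (contDiff_dLine_iterate m hψi) Q ?_ x ξ ξ'
      intro k z
      rw [dLine_iterate_comm _ _ m hψi, dLine_comm _ _ hψ.smooth]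
      exact hψ.bX i k r m hm z
    have hvar : ∀ x, |g x - g x₀| ≤ n * (n * Q * l) * ‖x - x₀‖ := fun x =>
      mvt_coord g (hgs.differentiable (by simp)) (n * Q * l)
        (fun r z => hit r 1 (by omega) z) x x₀
    have hlowg : ∀ x ∈ Metric.ball x₀ (2 * ρ), l / (4 * M) ≤ |g x| := by
      intro x hx
      have h2 : ‖x - x₀‖ ≤ 2 * ρ := by
        have := Metric.mem_ball.1 hx
        rw [dist_eq_norm] at this
        exact this.le
      have h3 : n * (n * Q * l) * ‖x - x₀‖ ≤ l / (4 * M) := by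
        calc _ ≤ n * (n * Q * l) * (2 * ρ) := by gcongr
          _ ≤ l * ((n * (n * Q) + 1) * (2 * ρ)) := by
            have : 0 ≤ l * (2 * ρ) := by positivity
            nlinarith
          _ = l / (4 * M) := by rw [hρ]; field_simp; norm_num
      have h4 := hvar x
      have h5 : |g x₀| ≤ |g x| + |g x - g x₀| := by
        have := abs_sub_abs_le_abs_sub (g x₀) (g x)
        rw [abs_sub_comm (g x₀)] at this
        linarith
      have h6 : l / (2 * M) = l / (4 * M) + l / (4 * M) := by field_simp; norm_num
      have h7 : l / (2 * M) < |g x₀| := hi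
      linarith
    have key := hns (EuclideanSpace.single i 1) (Metric.ball x₀ (2 * ρ)) (Metric.closedBall x₀ ρ)
      Metric.isOpen_ball (Metric.closedBall_subset_ball (by linarith)) (isCompact_closedBall _ _)
      (fun x => ψ (x, ξ') - ψ (x, ξ)) (fun x => (l : ℂ)⁻¹ * (g x : ℂ)) w l W hl1 hW
      ((slice_smoothX hψ.smooth ξ').sub (slice_smoothX hψ.smooth ξ))
      (contDiff_const.mul (Complex.ofRealCLM.contDiff.comp hgs)) hw ?_ ?_ ?_ ?_ hsupp
    · refine key.trans ?_
      rw [hVx]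
      have h3 : l⁻¹ ^ (2 * n + 1) ≤ 2 ^ (2 * n + 1) * ((1 + l)⁻¹) ^ (2 * n + 1) := by
        rw [← mul_pow]
        refine pow_le_pow_left₀ (by positivity) ?_ _
        rw [← div_eq_mul_inv, inv_eq_one_div, div_le_div_iff₀ hl1 (by positivity)]
        linarith
      calc C * W * l⁻¹ ^ (2 * n + 1) * V
          ≤ (C + 1) * W * (2 ^ (2 * n + 1) * ((1 + l)⁻¹) ^ (2 * n + 1)) * V := by
            gcongr; linarith
        _ = _ := by ring
    · intro x
      have := congrFun (iter_diff i ξ ξ' 1 hψ.smooth) x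
      simp only [Function.iterate_one] at this
      rw [this]
      have hlc : (l : ℂ) ≠ 0 := by exact_mod_cast hl1.ne'
      field_simp
      rfl
    · intro x hx
      rw [norm_mul, norm_inv, Complex.norm_real, Complex.norm_real, Real.norm_eq_abs,
        Real.norm_eq_abs, abs_of_pos hl1, ← div_eq_inv_mul, le_div_iff₀ hl1]
      have := hlowg x hx
      calc 1 / (4 * M) * l = l / (4 * M) := by ring
        _ ≤ _ := this
    · refine Bd.of_iterate fun j hj x _ => ?_
      rw [iter_ofReal _ _ j hgs, norm_mul, norm_inv, Complex.norm_real, Complex.norm_real,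
        Real.norm_eq_abs, Real.norm_eq_abs, abs_of_pos hl1, ← div_eq_inv_mul, div_le_iff₀ hl1]
      exact hit i j hj x
    · exact (hBd i).mono_set (Set.subset_univ _)

end Osc


section Kernels

/-- Euclidean space. -/
abbrev Eu (n : ℕ) := EuclideanSpace ℝ (Fin n)

variable {n : ℕ}

/-- Continuous kernels supported in `R × S` with compact `R`, `S`. -/
structure IsKer (κ : Eu n × Eu n → ℂ) (R S : Set (Eu n)) : Prop where
  cont : Continuous κ
  cR : IsCompact R
  cS : IsCompact S
  zR : ∀ x y, x ∉ R → κ (x, y) = 0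
  zS : ∀ x y, y ∉ S → κ (x, y) = 0

theorem IsKer.bound {κ : Eu n × Eu n → ℂ} {R S : Set (Eu n)} (h : IsKer κ R S) :
    ∃ B, 0 ≤ B ∧ ∀ z, ‖κ z‖ ≤ B := by
  have hc : HasCompactSupport κ := by
    refine HasCompactSupport.intro (h.cR.prod h.cS) ?_
    rintro ⟨x, y⟩ hxy
    by_cases hx : x ∈ R
    · exact h.zS x y fun hy => hxy ⟨hx, hy⟩
    · exact h.zR x y hx
  obtain ⟨B, hB⟩ := h.cont.bounded_above_of_compact_support hc
  exact ⟨B, (norm_nonneg _).trans (hB 0), hB⟩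

theorem IsKer.adj {κ : Eu n × Eu n → ℂ} {R S : Set (Eu n)} (h : IsKer κ R S) :
    IsKer (fun z => (starRingEnd ℂ) (κ (z.2, z.1))) S R where
  cont := Complex.continuous_conj.comp (h.cont.comp continuous_swap)
  cR := h.cS
  cS := h.cR
  zR x y hx := by simp [h.zS y x hx]
  zS x y hy := by simp [h.zR y x hy]

theorem l1_le {f : Eu n → ℂ} (hf : MemLp f 2) {S : Set (Eu n)} (hS : IsCompact S) :
    Integrable (S.indicator fun y => ‖f y‖) ∧
    ∫ y, S.indicator (fun y => ‖f y‖) y ≤ √(volume.real S) * (eLpNorm f 2 volume).toReal := by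
  have hfin : IsFiniteMeasure (volume.restrict S) := ⟨by
    rw [Measure.restrict_apply_univ]; exact hS.measure_lt_top⟩
  have h1 : MemLp f 1 (volume.restrict S) := (hf.restrict S).mono_exponent (by norm_num)
  have h2 : IntegrableOn (fun y => ‖f y‖) S := (memLp_one_iff_integrable.1 h1).norm
  refine ⟨(integrable_indicator_iff hS.measurableSet).2 h2, ?_⟩
  rw [integral_indicator hS.measurableSet]
  have h3 := eLpNorm_le_eLpNorm_mul_rpow_measure_univ (p := 1) (q := 2)
    (μ := volume.restrict S) (f := f) (by norm_num) (hf.restrict S).1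
  have h4 : ∫ y in S, ‖f y‖ = (eLpNorm f 1 (volume.restrict S)).toReal := by
    rw [eLpNorm_one_eq_lintegral_enorm, integral_norm_eq_lintegral_enorm (hf.restrict S).1]
  rw [h4]
  have h5 : eLpNorm f 1 (volume.restrict S) ≤
      eLpNorm f 2 volume * (volume S) ^ (1 / 2 : ℝ) := by
    refine h3.trans ?_
    have e : (1 / (1 : ℝ≥0∞).toReal - 1 / (2 : ℝ≥0∞).toReal) = (1 / 2 : ℝ) := by
      simp; norm_num
    rw [e, Measure.restrict_apply_univ]
    gcongr
    exact Measure.restrict_le_self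
  have hne : eLpNorm f 2 volume * (volume S) ^ (1 / 2 : ℝ) ≠ ⊤ :=
    ENNReal.mul_ne_top hf.2.ne (ENNReal.rpow_ne_top_of_nonneg (by norm_num) hS.measure_lt_top.ne)
  refine (ENNReal.toReal_mono hne h5).trans ?_
  rw [ENNReal.toReal_mul, ← ENNReal.toReal_rpow, mul_comm, Real.sqrt_eq_rpow]
  rfl

theorem IsKer.integrable {κ : Eu n × Eu n → ℂ} {R S : Set (Eu n)} (h : IsKer κ R S)
    {f : Eu n → ℂ} (hf : MemLp f 2) (x : Eu n) : Integrable fun y => κ (x, y) * f y := by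
  obtain ⟨B, hB0, hB⟩ := h.bound
  refine ((l1_le hf h.cS).1.const_mul B).mono' ?_ ?_
  · exact ((h.cont.comp (by fun_prop)).aestronglyMeasurable).mul hf.1
  · refine Filter.Eventually.of_forall fun y => ?_
    rw [norm_mul]
    by_cases hy : y ∈ S
    · simp only [Set.indicator_of_mem hy]
      exact mul_le_mul_of_nonneg_right (hB _) (norm_nonneg _)
    · simp [h.zS x y hy, hy]

theorem IsKer.pointwise {κ : Eu n × Eu n → ℂ} {R S : Set (Eu n)} (h : IsKer κ R S) {B : ℝ}
    (hB : ∀ z, ‖κ z‖ ≤ B)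
    {f : Eu n → ℂ} (hf : MemLp f 2) (x : Eu n) : ‖∫ y, κ (x, y) * f y‖ ≤
      R.indicator (fun _ => B * (√(volume.real S) * (eLpNorm f 2 volume).toReal)) x := by
  have hB0 : 0 ≤ B := (norm_nonneg _).trans (hB 0)
  by_cases hx : x ∈ R
  · rw [Set.indicator_of_mem hx]
    have := l1_le hf h.cS
    refine (norm_integral_le_of_norm_le (this.1.const_mul B) ?_).trans ?_
    · refine Filter.Eventually.of_forall fun y => ?_
      rw [norm_mul]
      by_cases hy : y ∈ S
      · simp only [Set.indicator_of_mem hy]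
        exact mul_le_mul_of_nonneg_right (hB _) (norm_nonneg _)
      · simp [h.zS x y hy, hy]
    · rw [integral_const_mul]
      exact mul_le_mul_of_nonneg_left this.2 hB0
  · simp [h.zR x _ hx, hx]

theorem IsKer.aesm {κ : Eu n × Eu n → ℂ} (hc : Continuous κ)
    {f : Eu n → ℂ} (hf : AEStronglyMeasurable f volume) :
    AEStronglyMeasurable (fun x => ∫ y, κ (x, y) * f y) volume := by
  refine AEStronglyMeasurable.integral_prod_right' (f := fun z => κ z * f z.2) ?_
  exact hc.aestronglyMeasurable.mul hf.comp_snd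

theorem IsKer.memLp {κ : Eu n × Eu n → ℂ} {R S : Set (Eu n)} (h : IsKer κ R S) {B : ℝ}
    (hB : ∀ z, ‖κ z‖ ≤ B) {f : Eu n → ℂ} (hf : MemLp f 2) :
    MemLp (fun x => ∫ y, κ (x, y) * f y) 2 ∧
    (eLpNorm (fun x => ∫ y, κ (x, y) * f y) 2 volume).toReal ≤
      (√(volume.real R) * B * √(volume.real S)) * (eLpNorm f 2 volume).toReal := by
  have hB0 : 0 ≤ B := (norm_nonneg _).trans (hB 0)
  set c : ℝ := B * (√(volume.real S) * (eLpNorm f 2 volume).toReal) with hcdef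
  have hc0 : 0 ≤ c := by positivity
  have h1 : eLpNorm (fun x => ∫ y, κ (x, y) * f y) 2 volume ≤
      ENNReal.ofReal c * (volume R) ^ (1 / 2 : ℝ) := by
    refine (eLpNorm_mono_real (h.pointwise hB hf)).trans ?_
    have := eLpNorm_indicator_const (p := 2) (μ := volume) (c := c) h.cR.measurableSet (by simp)
      (by simp)
    rw [this]
    rw [Real.enorm_eq_ofReal hc0]
    simp
  have hne : ENNReal.ofReal c * (volume R) ^ (1 / 2 : ℝ) ≠ ⊤ :=
    ENNReal.mul_ne_top ENNReal.ofReal_ne_top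
      (ENNReal.rpow_ne_top_of_nonneg (by norm_num) h.cR.measure_lt_top.ne)
  refine ⟨⟨IsKer.aesm h.cont hf.1, lt_of_le_of_lt h1 (lt_top_iff_ne_top.2 hne)⟩, ?_⟩
  refine (ENNReal.toReal_mono hne h1).trans (le_of_eq ?_)
  rw [ENNReal.toReal_mul, ← ENNReal.toReal_rpow, ENNReal.toReal_ofReal hc0,
    Real.sqrt_eq_rpow (volume.real R), hcdef]
  change _ * (volume.real R) ^ (1 / 2 : ℝ) = _
  ring

/-- The integral operator with kernel `κ` on `L²`. -/
def HasKer (T : Lp ℂ 2 (volume : Measure (Eu n)) →L[ℂ] Lp ℂ 2 (volume : Measure (Eu n)))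
    (κ : Eu n × Eu n → ℂ) : Prop :=
  ∀ f : Lp ℂ 2 (volume : Measure (Eu n)), T f =ᵐ[volume] fun x => ∫ y, κ (x, y) * f y

theorem IsKer.exists_op {κ : Eu n × Eu n → ℂ} {R S : Set (Eu n)} (h : IsKer κ R S) :
    ∃ T, HasKer T κ := by
  obtain ⟨B, hB0, hB⟩ := h.bound
  let T : Lp ℂ 2 (volume : Measure (Eu n)) →ₗ[ℂ] Lp ℂ 2 (volume : Measure (Eu n)) :=
    { toFun := fun f => (h.memLp hB (Lp.memLp f)).1.toLp
      map_add' := by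
        intro f g
        rw [← MemLp.toLp_add]
        refine MemLp.toLp_congr _ _ ?_
        refine Filter.Eventually.of_forall fun x => ?_
        simp only [Pi.add_apply]
        rw [← integral_add (h.integrable (Lp.memLp f) x) (h.integrable (Lp.memLp g) x)]
        refine integral_congr_ae ?_
        filter_upwards [Lp.coeFn_add f g] with y hy
        rw [hy, Pi.add_apply, mul_add]
      map_smul' := by
        intro c f
        rw [RingHom.id_apply, ← MemLp.toLp_const_smul]
        refine MemLp.toLp_congr _ _ ?_
        refine Filter.Eventually.of_forall fun x => ?_
        simp only [Pi.smul_apply]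
        rw [smul_eq_mul, ← integral_const_mul]
        refine integral_congr_ae ?_
        filter_upwards [Lp.coeFn_smul c f] with y hy
        rw [hy, Pi.smul_apply, smul_eq_mul]
        ring }
  refine ⟨T.mkContinuous (√(volume.real R) * B * √(volume.real S)) ?_, ?_⟩
  · intro f
    change ‖(h.memLp hB (Lp.memLp f)).1.toLp‖ ≤ _
    rw [Lp.norm_toLp, Lp.norm_def]
    exact (h.memLp hB (Lp.memLp f)).2
  · intro f
    exact MemLp.coeFn_toLp (h.memLp hB (Lp.memLp f)).1

theorem HasKer.adj_eq {κ : Eu n × Eu n → ℂ} {R S : Set (Eu n)} (h : IsKer κ R S) {T T'}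
    (hT : HasKer T κ) (hT' : HasKer T' (fun z => (starRingEnd ℂ) (κ (z.2, z.1)))) :
    star T = T' := by
  obtain ⟨B, hB0, hB⟩ := h.bound
  rw [ContinuousLinearMap.star_eq_adjoint]
  symm
  rw [ContinuousLinearMap.eq_adjoint_iff]
  intro f g
  rw [L2.inner_def, L2.inner_def]
  have e1 : ∫ x, inner ℂ ((T' f : Eu n → ℂ) x) ((g : Eu n → ℂ) x) =
      ∫ x, ∫ y, κ (y, x) * (starRingEnd ℂ) ((f : Eu n → ℂ) y) * (g : Eu n → ℂ) x := by
    refine integral_congr_ae ?_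
    filter_upwards [hT' f] with x hx
    rw [hx, RCLike.inner_apply, ← integral_conj, mul_comm, ← integral_mul_const]
    simp
  have e2 : ∫ x, inner ℂ ((f : Eu n → ℂ) x) ((T g : Eu n → ℂ) x) =
      ∫ x, ∫ y, κ (x, y) * (starRingEnd ℂ) ((f : Eu n → ℂ) x) * (g : Eu n → ℂ) y := by
    refine integral_congr_ae ?_
    filter_upwards [hT g] with x hx
    rw [hx, RCLike.inner_apply, ← integral_mul_const]
    refine integral_congr_ae (Filter.Eventually.of_forall fun y => ?_)
    simp only
    ring
  rw [e1, e2, integral_integral_swap]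
  have hf := Lp.memLp f
  have hg := Lp.memLp g
  have hi := ((l1_le hg h.cS).1.mul_prod (l1_le hf h.cR).1).const_mul B
  refine hi.mono' ?_ ?_
  · refine AEStronglyMeasurable.mul (AEStronglyMeasurable.mul ?_ ?_) ?_
    · exact (h.cont.comp continuous_swap).aestronglyMeasurable
    · exact Complex.continuous_conj.comp_aestronglyMeasurable hf.1.comp_snd
    · exact hg.1.comp_fst
  · refine Filter.Eventually.of_forall fun z => ?_
    simp only [Function.uncurry]
    by_cases h1 : z.1 ∈ S
    · by_cases h2 : z.2 ∈ R
      · simp only [Set.indicator_of_mem h1, Set.indicator_of_mem h2, norm_mul, RCLike.norm_conj]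
        have := hB (z.2, z.1)
        calc _ ≤ B * ‖(f : Eu n → ℂ) z.2‖ * ‖(g : Eu n → ℂ) z.1‖ := by gcongr
          _ = _ := by ring
      · simp [h.zR z.2 z.1 h2, h2]
    · simp [h.zS z.2 z.1 h1, h1]

theorem HasKer.norm_star_mul {κ₁ κ₂ : Eu n × Eu n → ℂ} {R₁ S₁ R₂ S₂ : Set (Eu n)}
    (h₁ : IsKer κ₁ R₁ S₁) (h₂ : IsKer κ₂ R₂ S₂) {T₁ T₂} (hT₁ : HasKer T₁ κ₁) (hT₂ : HasKer T₂ κ₂)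
    {D V : ℝ} (hV₁ : volume.real S₁ ≤ V) (hV₂ : volume.real S₂ ≤ V)
    (hD : ∀ y z, ‖∫ x, (starRingEnd ℂ) (κ₁ (x, y)) * κ₂ (x, z)‖ ≤ D) :
    ‖star T₁ * T₂‖ ≤ V * D := by
  obtain ⟨B₁, hB₁0, hB₁⟩ := h₁.bound
  obtain ⟨B₂, hB₂0, hB₂⟩ := h₂.bound
  have hD0 : 0 ≤ D := (norm_nonneg _).trans (hD 0 0)
  have hV0 : 0 ≤ V := measureReal_nonneg.trans hV₁
  have main : ∀ f g, ‖inner ℂ (T₁ f) (T₂ g)‖ ≤ V * D * (‖f‖ * ‖g‖) := by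
    intro f g
    have hf := Lp.memLp f
    have hg := Lp.memLp g
    rw [L2.inner_def]
    have e1 : ∫ x, inner ℂ ((T₁ f : Eu n → ℂ) x) ((T₂ g : Eu n → ℂ) x) =
        ∫ x, ∫ p : Eu n × Eu n, ((starRingEnd ℂ) (κ₁ (x, p.1)) * (starRingEnd ℂ) (f p.1)) *
          (κ₂ (x, p.2) * g p.2) ∂(volume.prod volume) := by
      refine integral_congr_ae ?_
      filter_upwards [hT₁ f, hT₂ g] with x hx hx2
      rw [hx, hx2, RCLike.inner_apply, ← integral_conj]
      rw [integral_prod_mul (f := fun y => (starRingEnd ℂ) (κ₁ (x, y)) * (starRingEnd ℂ) (f y))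
        (g := fun y => κ₂ (x, y) * g y), mul_comm]
      simp
    have hi₁ := (l1_le hf h₁.cS)
    have hi₂ := (l1_le hg h₂.cS)
    have hR : Integrable (R₁.indicator fun _ : Eu n => (1 : ℝ)) :=
      (integrable_indicator_iff h₁.cR.measurableSet).2
        (integrableOn_const h₁.cR.measure_lt_top.ne)
    have hi12 := hi₁.1.mul_prod hi₂.1
    have hi := (hR.mul_prod hi12).const_mul (B₁ * B₂)
    rw [e1, integral_integral_swap]
    · refine (norm_integral_le_of_norm_le (hi12.const_mul D) ?_).trans ?_
      · refine Filter.Eventually.of_forall fun p => ?_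
        have e2 : ∫ x, ((starRingEnd ℂ) (κ₁ (x, p.1)) * (starRingEnd ℂ) (f p.1)) *
          (κ₂ (x, p.2) * g p.2) = (∫ x, (starRingEnd ℂ) (κ₁ (x, p.1)) * κ₂ (x, p.2)) *
            ((starRingEnd ℂ) (f p.1) * g p.2) := by
          rw [← integral_mul_const]
          refine integral_congr_ae (Filter.Eventually.of_forall fun y => ?_)
          simp only
          ring
        rw [e2]
        by_cases hp1 : p.1 ∈ S₁
        · by_cases hp2 : p.2 ∈ S₂
          · simp only [Set.indicator_of_mem hp1, Set.indicator_of_mem hp2]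
            rw [norm_mul, norm_mul, RCLike.norm_conj]
            exact mul_le_mul_of_nonneg_right (hD _ _) (by positivity)
          · simp [h₂.zS _ p.2 hp2, hp2]
        · simp [h₁.zS _ p.1 hp1, hp1]
      · rw [integral_const_mul, integral_prod_mul (f := S₁.indicator fun y => ‖f y‖)
          (g := S₂.indicator fun y => ‖g y‖), Lp.norm_def, Lp.norm_def]
        have k1 := hi₁.2.trans (mul_le_mul_of_nonneg_right (Real.sqrt_le_sqrt hV₁)
          ENNReal.toReal_nonneg)
        have k2 := hi₂.2.trans (mul_le_mul_of_nonneg_right (Real.sqrt_le_sqrt hV₂)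
          ENNReal.toReal_nonneg)
        have k3 : 0 ≤ ∫ y, S₂.indicator (fun y => ‖g y‖) y :=
          integral_nonneg fun y => Set.indicator_nonneg (fun _ _ => norm_nonneg _) y
        calc _ ≤ D * ((√V * (eLpNorm f 2 volume).toReal) * (√V * (eLpNorm g 2 volume).toReal)) := by
              refine mul_le_mul_of_nonneg_left (mul_le_mul k1 k2 k3 (by positivity)) hD0
          _ = (√V * √V) * D * ((eLpNorm f 2 volume).toReal * (eLpNorm g 2 volume).toReal) := by ring
          _ = _ := by rw [Real.mul_self_sqrt hV0]
    · refine hi.mono' ?_ ?_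
      · have m1 : AEStronglyMeasurable (fun z : Eu n × Eu n × Eu n =>
            (starRingEnd ℂ) (κ₁ (z.1, z.2.1))) (volume.prod (volume.prod volume)) :=
          Continuous.aestronglyMeasurable
            (Complex.continuous_conj.comp (h₁.cont.comp (by fun_prop)))
        have m2 : AEStronglyMeasurable (fun z : Eu n × Eu n × Eu n =>
            κ₂ (z.1, z.2.2)) (volume.prod (volume.prod volume)) :=
          Continuous.aestronglyMeasurable (h₂.cont.comp (by fun_prop))
        have m3 : AEStronglyMeasurable (fun z : Eu n × Eu n × Eu n =>
            (starRingEnd ℂ) (f z.2.1)) (volume.prod (volume.prod volume)) :=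
          Complex.continuous_conj.comp_aestronglyMeasurable
            (hf.1.comp_fst (ν := volume)).comp_snd
        have m4 : AEStronglyMeasurable (fun z : Eu n × Eu n × Eu n =>
            g z.2.2) (volume.prod (volume.prod volume)) :=
          (hg.1.comp_snd (μ := volume)).comp_snd
        exact (m1.mul m3).mul (m2.mul m4)
      · refine Filter.Eventually.of_forall fun z => ?_
        simp only [Function.uncurry]
        by_cases hr : z.1 ∈ R₁
        · by_cases hp1 : z.2.1 ∈ S₁
          · by_cases hp2 : z.2.2 ∈ S₂
            · simp only [Set.indicator_of_mem hp1, Set.indicator_of_mem hp2,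
                Set.indicator_of_mem hr, norm_mul, RCLike.norm_conj]
              have b1 := hB₁ (z.1, z.2.1)
              have b2 := hB₂ (z.1, z.2.2)
              calc _ ≤ B₁ * ‖(f : Eu n → ℂ) z.2.1‖ * (B₂ * ‖(g : Eu n → ℂ) z.2.2‖) := by gcongr
                _ = _ := by ring
            · simp [h₂.zS _ _ hp2, hp2]
          · simp [h₁.zS _ _ hp1, hp1]
        · simp [h₁.zR _ _ hr, hr]
  refine ContinuousLinearMap.opNorm_le_bound _ (by positivity) fun g => ?_
  set A := (star T₁ * T₂) g with hA
  have h3 : ‖A‖ ^ 2 ≤ V * D * (‖A‖ * ‖g‖) := by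
    refine le_trans (le_of_eq ?_) (main A g)
    have e : inner ℂ (T₁ A) (T₂ g) = inner ℂ A A := by
      rw [← ContinuousLinearMap.adjoint_inner_right]
      rfl
    rw [e, inner_self_eq_norm_sq_to_K]
    simp
  rcases (norm_nonneg A).eq_or_lt with h0 | h0
  · rw [← h0]; positivity
  · nlinarith

theorem op_sum_bound {ι : Type} [Fintype ι] (κ : ι → Eu n × Eu n → ℂ) (R S : ι → Set (Eu n))
    (h : ∀ i, IsKer (κ i) (R i) (S i)) (V : ℝ) (hR : ∀ i, volume.real (R i) ≤ V)
    (hS : ∀ i, volume.real (S i) ≤ V) (D₁ D₂ : ι → ι → ℝ)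
    (hD₁ : ∀ i j y z, ‖∫ x, (starRingEnd ℂ) (κ i (x, y)) * κ j (x, z)‖ ≤ D₁ i j)
    (hD₂ : ∀ i j y z, ‖∫ x, κ i (y, x) * (starRingEnd ℂ) (κ j (z, x))‖ ≤ D₂ i j)
    (B : ℝ) (hB : 0 ≤ B) (hs₁ : ∀ j, ∑ i, √(V * D₁ i j) ≤ B) (hs₂ : ∀ j, ∑ i, √(V * D₂ i j) ≤ B)
    {f : Eu n → ℂ} (hf : MemLp f 2) :
    eLpNorm (fun x => ∫ y, (∑ i, κ i (x, y)) * f y) 2 volume ≤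
      ENNReal.ofReal B * eLpNorm f 2 volume := by
  choose T hT using fun i => (h i).exists_op
  choose T' hT' using fun i => (h i).adj.exists_op
  have hadj : ∀ i, star (T i) = T' i := fun i => HasKer.adj_eq (h i) (hT i) (hT' i)
  have hnorm : ‖∑ i, T i‖ ≤ B := by
    refine cotlar_stein T B hB (fun j => (Finset.sum_le_sum fun i _ => ?_).trans (hs₁ j))
      (fun j => (Finset.sum_le_sum fun i _ => ?_).trans (hs₂ j))
    · exact Real.sqrt_le_sqrt ((HasKer.norm_star_mul (h i) (h j) (hT i) (hT j) (hS i) (hS j)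
        (hD₁ i j)))
    · have e : T i = star (T' i) := by rw [← hadj, star_star]
      rw [hadj j, e]
      refine Real.sqrt_le_sqrt ((HasKer.norm_star_mul (h i).adj (h j).adj (hT' i) (hT' j) (hR i)
        (hR j) ?_))
      intro y z
      simpa using hD₂ i j y z
  set F := hf.toLp with hF
  have hFf : F =ᵐ[volume] f := hf.coeFn_toLp
  have e1 : (fun x => ∫ y, (∑ i, κ i (x, y)) * f y) =ᵐ[volume] (∑ i, T i) F := by
    rw [_root_.sum_apply]
    have h1 := Lp.coeFn_finsetSum (p := 2) (μ := (volume : Measure (Eu n))) Finset.univ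
      (fun i => T i F)
    have h2 : ∀ᵐ x, ∀ i, (T i F : Eu n → ℂ) x = ∫ y, κ i (x, y) * F y :=
      ae_all_iff.2 fun i => hT i F
    filter_upwards [h1, h2] with x hx hx2
    rw [hx, Finset.sum_apply, Finset.sum_congr rfl fun i _ => hx2 i,
      ← integral_finsetSum _ fun i _ => (h i).integrable (Lp.memLp F) x]
    refine integral_congr_ae ?_
    filter_upwards [hFf] with y hy
    rw [hy, Finset.sum_mul]
  rw [eLpNorm_congr_ae e1]
  have h2 : ‖(∑ i, T i) F‖ ≤ B * ‖F‖ :=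
    (ContinuousLinearMap.le_opNorm _ _).trans (mul_le_mul_of_nonneg_right hnorm (norm_nonneg _))
  rw [← eLpNorm_congr_ae hFf]
  rw [Lp.norm_def, Lp.norm_def] at h2
  have h3 := ENNReal.ofReal_le_ofReal h2
  rwa [ENNReal.ofReal_toReal (Lp.memLp _).2.ne, ENNReal.ofReal_mul hB,
    ENNReal.ofReal_toReal (Lp.memLp _).2.ne] at h3

end Kernels


section Cutoffs

/-- One dimensional cutoff whose integer translates sum to one. -/
def chi0 (t : ℝ) : ℝ := Real.smoothTransition (t + 1) - Real.smoothTransition t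

theorem chi0_nonneg (t : ℝ) : 0 ≤ chi0 t :=
  sub_nonneg.2 (Real.smoothTransition.monotone (by linarith))

theorem chi0_le_one (t : ℝ) : chi0 t ≤ 1 := by
  have h1 := Real.smoothTransition.le_one (t + 1)
  have h2 := Real.smoothTransition.nonneg t
  unfold chi0; linarith

theorem chi0_zero {t : ℝ} (h : 1 < |t|) : chi0 t = 0 := by
  unfold chi0
  rcases lt_abs.1 h with h | h
  · rw [Real.smoothTransition.one_of_one_le (by linarith),
      Real.smoothTransition.one_of_one_le (by linarith), sub_self]
  · rw [Real.smoothTransition.zero_of_nonpos (by linarith),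
      Real.smoothTransition.zero_of_nonpos (by linarith), sub_self]

theorem chi0_smooth : ContDiff ℝ (⊤ : ℕ∞) chi0 :=
  (Real.smoothTransition.contDiff.comp (contDiff_id.add contDiff_const)).sub
    Real.smoothTransition.contDiff

theorem chi0_sum (t : ℝ) (N : ℕ) : ∑ m : Fin N, chi0 (t - m) =
    Real.smoothTransition (t + 1) - Real.smoothTransition (t + 1 - N) := by
  rw [Fin.sum_univ_eq_sum_range (fun m => chi0 (t - m)) N]
  have := Finset.sum_range_sub (fun m : ℕ => - Real.smoothTransition (t + 1 - m)) N
  simp only [Nat.cast_zero, sub_zero] at this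
  rw [show Real.smoothTransition (t + 1) - Real.smoothTransition (t + 1 - N) =
    -Real.smoothTransition (t + 1 - N) - -Real.smoothTransition (t + 1) by ring, ← this]
  refine Finset.sum_congr rfl fun m _ => ?_
  unfold chi0
  push_cast
  rw [show t + 1 - ((m : ℝ) + 1) = t - m by ring, show t - (m : ℝ) + 1 = t + 1 - m by ring]
  ring

variable {n : ℕ}

/-- Cutoff at scale `ε` around the point `ε k`. -/
def chi (ε : ℝ) (k : Fin n → ℝ) (x : Eu n) : ℝ := ∏ i, chi0 (x i / ε - k i)

theorem chi_nonneg (ε : ℝ) (k : Fin n → ℝ) (x : Eu n) : 0 ≤ chi ε k x :=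
  Finset.prod_nonneg fun _ _ => chi0_nonneg _

theorem chi_le_one (ε : ℝ) (k : Fin n → ℝ) (x : Eu n) : chi ε k x ≤ 1 :=
  Finset.prod_le_one (fun _ _ => chi0_nonneg _) fun _ _ => chi0_le_one _

theorem chi_smooth (ε : ℝ) (k : Fin n → ℝ) : ContDiff ℝ (⊤ : ℕ∞) (chi ε k) := by
  refine contDiff_prod fun i _ => chi0_smooth.comp ?_
  have : ContDiff ℝ (⊤ : ℕ∞) (fun x : Eu n => x i) := (EuclideanSpace.proj (𝕜 := ℝ) i).contDiff
  exact (this.div_const ε).sub contDiff_const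

theorem chi_coord {ε : ℝ} {k : Fin n → ℝ} {x : Eu n} (h : chi ε k x ≠ 0) (i : Fin n) :
    |x i / ε - k i| ≤ 1 := by
  by_contra hc
  push Not at hc
  exact h (Finset.prod_eq_zero (Finset.mem_univ i) (chi0_zero hc))

/-- Center of the cutoff. -/
def cen (ε : ℝ) (k : Fin n → ℝ) : Eu n := WithLp.toLp 2 fun i => ε * k i

theorem chi_ball {ε : ℝ} (hε : 0 < ε) {k : Fin n → ℝ} {x : Eu n} (h : chi ε k x ≠ 0) :
    x ∈ Metric.closedBall (cen ε k) (n * ε) := by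
  rw [Metric.mem_closedBall, dist_eq_norm]
  refine norm_le_card_mul _ _ fun i => ?_
  have h1 := chi_coord h i
  have e : (x - cen ε k) i = ε * (x i / ε - k i) := by
    simp [cen]
    field_simp
  rw [e, abs_mul, abs_of_pos hε]
  nlinarith

theorem chi_translate {ε : ℝ} (hε : 0 < ε) (k : Fin n → ℝ) (x : Eu n) :
    chi ε k x = chi ε 0 (x - cen ε k) := by
  unfold chi
  refine Finset.prod_congr rfl fun i _ => ?_
  congr 1
  simp [cen]
  field_simp

theorem iter_translate {E F : Type*} [NormedAddCommGroup E] [NormedSpace ℝ E]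
    [NormedAddCommGroup F] [NormedSpace ℝ F] (v a : E) (m : ℕ) :
    ∀ f : E → F, (dLine v)^[m] (fun x => f (x - a)) = fun x => (dLine v)^[m] f (x - a) := by
  induction m with
  | zero => intro f; rfl
  | succ m ih =>
    intro f
    have e : dLine v (fun x => f (x - a)) = fun x => dLine v f (x - a) := by
      ext x
      change fderiv ℝ (fun x => f (x - a)) x v = _
      rw [fderiv_comp_sub]
      rfl
    rw [Function.iterate_succ_apply, e, ih]
    rfl

theorem iter_compact {E : Type*} [NormedAddCommGroup E] [NormedSpace ℝ E] (v : E) (m : ℕ) :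
    ∀ {f : E → ℂ}, HasCompactSupport f → HasCompactSupport ((dLine v)^[m] f) := by
  induction m with
  | zero => intro f hf; exact hf
  | succ m ih =>
    intro f hf
    rw [Function.iterate_succ_apply]
    exact ih (hf.fderiv_apply ℝ v)

theorem iter_conj {E : Type*} [NormedAddCommGroup E] [NormedSpace ℝ E] (v : E) (m : ℕ) :
    ∀ {f : E → ℂ}, ContDiff ℝ (⊤ : ℕ∞) f →
    (dLine v)^[m] (fun x => (starRingEnd ℂ) (f x)) =
      fun x => (starRingEnd ℂ) ((dLine v)^[m] f x) := by
  induction m with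
  | zero => intro f hf; rfl
  | succ m ih =>
    intro f hf
    have e : dLine v (fun x => (starRingEnd ℂ) (f x)) =
        fun x => (starRingEnd ℂ) (dLine v f x) := by
      ext x
      have h1 := (hf.differentiable (by simp) x).hasFDerivAt
      have h2 : HasFDerivAt (fun x => (starRingEnd ℂ) (f x)) _ x :=
        (Complex.conjCLE : ℂ →L[ℝ] ℂ).hasFDerivAt.comp x h1
      change fderiv ℝ (fun x => (starRingEnd ℂ) (f x)) x v = _
      rw [h2.fderiv]
      simp [dLine]
    rw [Function.iterate_succ_apply, e, ih (contDiff_dLine hf)]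
    rfl

theorem chi_bd (n N : ℕ) {ε : ℝ} (hε : 0 < ε) : ∃ K, 1 ≤ K ∧ ∀ (k : Fin n → ℝ) (r : Fin n),
    Bd (EuclideanSpace.single r (1 : ℝ)) Set.univ N K (fun x => ((chi ε k x : ℝ) : ℂ)) := by
  have hs : ContDiff ℝ (⊤ : ℕ∞) (fun x : Eu n => ((chi ε 0 x : ℝ) : ℂ)) :=
    Complex.ofRealCLM.contDiff.comp (chi_smooth ε 0)
  have hc : HasCompactSupport (fun x : Eu n => ((chi ε 0 x : ℝ) : ℂ)) := by
    refine HasCompactSupport.intro (isCompact_closedBall (cen ε 0) (n * ε)) fun x hx => ?_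
    by_contra h
    exact hx (chi_ball hε fun h0 => h (by rw [h0]; rfl))
  have hb : ∀ (r : Fin n) (m : ℕ), ∃ K, ∀ x,
      ‖(dLine (EuclideanSpace.single r (1 : ℝ)))^[m] (fun x : Eu n => ((chi ε 0 x : ℝ) : ℂ)) x‖ ≤ K :=
    fun r m => (contDiff_dLine_iterate m hs).continuous.bounded_above_of_compact_support
      (iter_compact _ m hc)
  choose K hK using hb
  have hK0 : ∀ r m, 0 ≤ K r m := fun r m => (norm_nonneg _).trans (hK r m 0)
  refine ⟨1 + ∑ r, ∑ m ∈ Finset.range (N + 1), K r m, ?_, ?_⟩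
  · have : 0 ≤ ∑ r, ∑ m ∈ Finset.range (N + 1), K r m :=
      Finset.sum_nonneg fun r _ => Finset.sum_nonneg fun m _ => hK0 r m
    linarith
  · intro k r
    refine Bd.of_iterate fun j hj x _ => ?_
    have e : (fun x => ((chi ε k x : ℝ) : ℂ)) = fun x => ((chi ε 0 (x - cen ε k) : ℝ) : ℂ) := by
      ext x; rw [chi_translate hε]
    rw [e, iter_translate _ _ j (fun x : Eu n => ((chi ε 0 x : ℝ) : ℂ))]
    refine (hK r j _).trans ?_
    have h1 : K r j ≤ ∑ m ∈ Finset.range (N + 1), K r m :=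
      Finset.single_le_sum (f := fun m => K r m) (fun m _ => hK0 r m)
        (Finset.mem_range.2 (by omega))
    have h2 : ∑ m ∈ Finset.range (N + 1), K r m ≤ ∑ r, ∑ m ∈ Finset.range (N + 1), K r m :=
      Finset.single_le_sum (f := fun r => ∑ m ∈ Finset.range (N + 1), K r m)
        (fun r _ => Finset.sum_nonneg fun m _ => hK0 r m) (Finset.mem_univ r)
    linarith

/-- Grid points. -/
def grid (M : ℕ) (k : Fin n → Fin (2 * M + 1)) : Fin n → ℝ := fun i => ((k i : ℕ) : ℝ) - M

theorem sum_pi_prod {M : ℕ} (g : Fin n → Fin M → ℝ) :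
    ∑ k : Fin n → Fin M, ∏ i, g i (k i) = ∏ i, ∑ m, g i m := by
  rw [Finset.prod_univ_sum, Fintype.piFinset_univ]

/-- The partial sums of the partition of unity. -/
def theta (ε : ℝ) (M : ℕ) (x : Eu n) : ℝ :=
  ∏ i, (Real.smoothTransition (x i / ε + M + 1) - Real.smoothTransition (x i / ε - M))

theorem chi_sum (ε : ℝ) (M : ℕ) (x : Eu n) :
    ∑ k : Fin n → Fin (2 * M + 1), chi ε (grid M k) x = theta ε M x := by
  unfold chi grid theta
  rw [sum_pi_prod (fun i (m : Fin (2 * M + 1)) => chi0 (x i / ε - (((m : ℕ) : ℝ) - M)))]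
  refine Finset.prod_congr rfl fun i _ => ?_
  have := chi0_sum (x i / ε + M) (2 * M + 1)
  rw [show x i / ε + M + 1 - ((2 * M + 1 : ℕ) : ℝ) = x i / ε - M by push_cast; ring] at this
  rw [← this]
  refine Finset.sum_congr rfl fun m _ => ?_
  congr 1
  ring

theorem theta_abs (ε : ℝ) (M : ℕ) (x : Eu n) : |theta ε M x| ≤ 1 := by
  unfold theta
  rw [Finset.abs_prod]
  refine Finset.prod_le_one (fun _ _ => abs_nonneg _) fun i _ => ?_
  have h1 := Real.smoothTransition.le_one (x i / ε + M + 1)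
  have h2 := Real.smoothTransition.nonneg (x i / ε + M + 1)
  have h3 := Real.smoothTransition.le_one (x i / ε - M)
  have h4 := Real.smoothTransition.nonneg (x i / ε - M)
  rw [abs_le]; constructor <;> linarith

theorem theta_tendsto (ε : ℝ) (x : Eu n) :
    ∀ᶠ M : ℕ in Filter.atTop, theta ε M x = 1 := by
  have h : ∀ i : Fin n, ∀ᶠ M : ℕ in Filter.atTop, |x i / ε| ≤ M := by
    intro i
    obtain ⟨M₀, hM₀⟩ := exists_nat_ge |x i / ε|
    filter_upwards [Filter.eventually_ge_atTop M₀] with M hM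
    exact hM₀.trans (by exact_mod_cast hM)
  filter_upwards [Filter.eventually_all.2 h] with M hM
  unfold theta
  refine Finset.prod_eq_one fun i _ => ?_
  have := abs_le.1 (hM i)
  rw [Real.smoothTransition.one_of_one_le (by linarith),
    Real.smoothTransition.zero_of_nonpos (by linarith), sub_zero]

theorem grid_sum (c p : ℝ) (hc : 0 ≤ c) (hp : 1 < p) : ∃ Γ, 0 ≤ Γ ∧
    ∀ (M : ℕ) (m' : Fin (2 * M + 1)), ∑ m : Fin (2 * M + 1),
      (c / (1 + |((m : ℕ) : ℝ) - ((m' : ℕ) : ℝ)|)) ^ p ≤ Γ := by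
  have hs : Summable fun m : ℤ => (c / (1 + |(m : ℝ)|)) ^ p := by
    have h1 := (Real.summable_abs_int_rpow hp).mul_left (c ^ p)
    refine Summable.of_norm_bounded_eventually h1 ?_
    rw [Filter.eventually_cofinite]
    refine (Set.finite_singleton (0 : ℤ)).subset ?_
    intro m hm
    by_contra h0
    refine hm ?_
    have hm0 : (0 : ℝ) < |(m : ℝ)| := by
      rw [abs_pos]; exact_mod_cast h0
    rw [Real.norm_of_nonneg (by positivity), Real.rpow_neg hm0.le, ← div_eq_mul_inv,
      ← Real.div_rpow hc hm0.le]
    refine Real.rpow_le_rpow (by positivity) ?_ (by linarith)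
    exact div_le_div_of_nonneg_left hc hm0 (by linarith)
  refine ⟨∑' m : ℤ, (c / (1 + |(m : ℝ)|)) ^ p, tsum_nonneg fun m => by positivity, ?_⟩
  intro M m'
  have hinj : Function.Injective (fun m : Fin (2 * M + 1) => ((m : ℕ) : ℤ) - ((m' : ℕ) : ℤ)) := by
    intro a b hab
    simp only at hab
    ext; omega
  have := Summable.sum_le_tsum (Finset.univ.map ⟨_, hinj⟩) (fun m _ => by positivity) hs
  rw [Finset.sum_map] at this
  simpa using this

end Cutoffs


section Assembly

variable {n : ℕ}

theorem dLine_swap {F : Type*} [NormedAddCommGroup F] [NormedSpace ℝ F]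
    (v : Eu n × Eu n) {f : Eu n × Eu n → F} (hf : ContDiff ℝ (⊤ : ℕ∞) f) :
    dLine v (fun z => f z.swap) = fun z => dLine v.swap f z.swap := by
  ext z
  have h1 := (hf.differentiable (by simp) z.swap).hasFDerivAt
  have h0 : HasFDerivAt (Prod.swap : Eu n × Eu n → Eu n × Eu n)
      ((ContinuousLinearMap.snd ℝ (Eu n) (Eu n)).prod (ContinuousLinearMap.fst ℝ (Eu n) (Eu n))) z :=
    hasFDerivAt_snd.prodMk hasFDerivAt_fst
  have h2 : HasFDerivAt (fun z => f z.swap) _ z :=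
    HasFDerivAt.comp z h1 h0
  change fderiv ℝ (fun z => f z.swap) z v = _
  rw [h2.fderiv]
  rfl

theorem smooth_swap {F : Type*} [NormedAddCommGroup F] [NormedSpace ℝ F]
    {f : Eu n × Eu n → F} (hf : ContDiff ℝ (⊤ : ℕ∞) f) :
    ContDiff ℝ (⊤ : ℕ∞) (fun z : Eu n × Eu n => f z.swap) :=
  hf.comp (contDiff_snd.prodMk contDiff_fst)

theorem iter_swap {F : Type*} [NormedAddCommGroup F] [NormedSpace ℝ F]
    (v : Eu n × Eu n) (m : ℕ) : ∀ {f : Eu n × Eu n → F}, ContDiff ℝ (⊤ : ℕ∞) f →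
    (dLine v)^[m] (fun z => f z.swap) = fun z => (dLine v.swap)^[m] f z.swap := by
  induction m with
  | zero => intro f hf; rfl
  | succ m ih =>
    intro f hf
    rw [Function.iterate_succ_apply, dLine_swap v hf, ih (contDiff_dLine hf)]
    rfl

theorem PhaseHyp.swap {C₀ Q : ℝ} {ψ : Eu n × Eu n → ℝ} (h : PhaseHyp n C₀ Q ψ) :
    PhaseHyp n C₀ Q (fun z => ψ z.swap) := by
  have e : ∀ i l, mixedHessXY (fun z => ψ z.swap) i l = fun z => mixedHessXY ψ l i z.swap := by
    intro i l
    unfold mixedHessXY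
    rw [dLine_swap _ h.smooth, dLine_swap _ (contDiff_dLine h.smooth), dLine_comm _ _ h.smooth]
    rfl
  have hs : ∀ i l, ContDiff ℝ (⊤ : ℕ∞) (mixedHessXY ψ i l) := fun i l =>
    contDiff_dLine (contDiff_dLine h.smooth)
  refine ⟨smooth_swap h.smooth, ?_, ?_, ?_⟩
  · intro z
    have := h.det z.swap
    rw [← Matrix.det_transpose] at this
    convert this using 4
    ext i j
    simp [e]
  · intro i l r m hm z
    rw [e, iter_swap _ _ (hs l i)]
    exact h.bY l i r m hm z.swap
  · intro i l r m hm z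
    rw [e, iter_swap _ _ (hs l i)]
    exact h.bX l i r m hm z.swap

/-- Hypotheses on the amplitude. -/
structure SymHyp (n : ℕ) (A : ℝ) (b : Eu n × Eu n → ℂ) : Prop where
  smooth : ContDiff ℝ (⊤ : ℕ∞) b
  b0 : ∀ z, ‖b z‖ ≤ A
  bX : ∀ r m, m ≤ 2 * n + 1 → ∀ z, ‖(dLine (dX r))^[m] b z‖ ≤ A
  bY : ∀ r m, m ≤ 2 * n + 1 → ∀ z, ‖(dLine (dY r))^[m] b z‖ ≤ A

theorem SymHyp.nonneg {A : ℝ} {b : Eu n × Eu n → ℂ} (h : SymHyp n A b) : 0 ≤ A :=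
  (norm_nonneg _).trans (h.b0 0)

theorem SymHyp.swap {A : ℝ} {b : Eu n × Eu n → ℂ} (h : SymHyp n A b) :
    SymHyp n A (fun z => b z.swap) := by
  refine ⟨smooth_swap h.smooth, fun z => h.b0 _, ?_, ?_⟩
  · intro r m hm z
    rw [iter_swap _ _ h.smooth]
    exact h.bY r m hm z.swap
  · intro r m hm z
    rw [iter_swap _ _ h.smooth]
    exact h.bX r m hm z.swap

/-- Localized kernels. -/
def kap (ε : ℝ) (ψ : Eu n × Eu n → ℝ) (b : Eu n × Eu n → ℂ) (j k : Fin n → ℝ)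
    (z : Eu n × Eu n) : ℂ :=
  ((chi ε j z.1 : ℝ) : ℂ) * ((chi ε k z.2 : ℝ) : ℂ) * (Complex.exp (Complex.I * (ψ z : ℂ)) * b z)

/-- Decay weight. -/
def gam (c p : ℝ) (k k' : Fin n → ℝ) : ℝ := ∏ i, (c / (1 + |k i - k' i|)) ^ p

theorem gam_nonneg {c p : ℝ} (hc : 0 ≤ c) (k k' : Fin n → ℝ) : 0 ≤ gam c p k k' :=
  Finset.prod_nonneg fun i _ => by positivity

theorem one_le_gam {c p : ℝ} (hp : 0 ≤ p) (k k' : Fin n → ℝ)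
    (h : ∀ i, 1 + |k i - k' i| ≤ c) : 1 ≤ gam c p k k' := by
  unfold gam
  have : ∀ i, 1 ≤ (c / (1 + |k i - k' i|)) ^ p := fun i =>
    Real.one_le_rpow (by rw [le_div_iff₀ (by positivity)]; linarith [h i]) hp
  calc (1 : ℝ) = ∏ i : Fin n, (1 : ℝ) := by simp
    _ ≤ _ := Finset.prod_le_prod (fun _ _ => zero_le_one) fun i _ => this i

theorem decay_le_gam {c p s : ℝ} (hp : 0 ≤ p) (hpn : 2 * n * p ≤ 2 * n + 1) (hs : 0 ≤ s)
    (k k' : Fin n → ℝ) (h : ∀ i, 1 + |k i - k' i| ≤ c * (1 + s)) :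
    ((1 + s)⁻¹) ^ (2 * n + 1) ≤ gam c p k k' ^ 2 := by
  have ht0 : 0 < (1 + s)⁻¹ := by positivity
  have ht1 : (1 + s)⁻¹ ≤ 1 := inv_le_one_of_one_le₀ (by linarith)
  have h1 : (((1 + s)⁻¹) ^ p) ^ n ≤ gam c p k k' := by
    unfold gam
    calc (((1 + s)⁻¹) ^ p) ^ n = ∏ i : Fin n, ((1 + s)⁻¹) ^ p := by simp
      _ ≤ _ := by
        refine Finset.prod_le_prod (fun _ _ => by positivity) fun i _ => ?_
        refine Real.rpow_le_rpow ht0.le ?_ hp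
        rw [inv_eq_one_div, div_le_div_iff₀ (by positivity) (by positivity)]
        linarith [h i]
  calc ((1 + s)⁻¹) ^ (2 * n + 1) = ((1 + s)⁻¹) ^ ((2 * n + 1 : ℕ) : ℝ) := (Real.rpow_natCast _ _).symm
    _ ≤ ((1 + s)⁻¹) ^ (2 * n * p) :=
        Real.rpow_le_rpow_of_exponent_ge ht0 ht1 (by push_cast; exact hpn)
    _ = ((((1 + s)⁻¹) ^ p) ^ n) ^ 2 := by
        rw [← Real.rpow_natCast, ← Real.rpow_natCast, ← Real.rpow_mul ht0.le, ← Real.rpow_mul ht0.le]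
        congr 1
        push_cast
        ring
    _ ≤ _ := pow_le_pow_left₀ (by positivity) h1 2

theorem kap_smooth {ε : ℝ} {ψ : Eu n × Eu n → ℝ} {b : Eu n × Eu n → ℂ}
    (hψ : Continuous ψ) (hb : Continuous b) (j k : Fin n → ℝ) :
    Continuous (kap ε ψ b j k) := by
  have h1 := (chi_smooth ε j).continuous
  have h2 := (chi_smooth ε k).continuous
  unfold kap
  fun_prop

theorem kap_isKer {ε : ℝ} (hε : 0 < ε) {ψ : Eu n × Eu n → ℝ} {b : Eu n × Eu n → ℂ}
    (hψ : Continuous ψ) (hb : Continuous b) (j k : Fin n → ℝ) :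
    IsKer (kap ε ψ b j k) (Metric.closedBall (cen ε j) (n * ε))
      (Metric.closedBall (cen ε k) (n * ε)) where
  cont := kap_smooth hψ hb j k
  cR := isCompact_closedBall _ _
  cS := isCompact_closedBall _ _
  zR x y hx := by
    have : chi ε j x = 0 := by
      by_contra h
      exact hx (chi_ball hε h)
    simp [kap, this]
  zS x y hy := by
    have : chi ε k y = 0 := by
      by_contra h
      exact hy (chi_ball hε h)
    simp [kap, this]

theorem kap_bound (n : ℕ) (C₀ Q : ℝ) (hC₀ : 0 < C₀) (hQ : 0 < Q) (p : ℝ) (hp : 0 ≤ p)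
    (hpn : 2 * n * p ≤ 2 * n + 1) : ∃ ε c C : ℝ, 0 < ε ∧ 0 ≤ c ∧ 0 ≤ C ∧
    ∀ ψ, PhaseHyp n C₀ Q ψ → ∀ A b, SymHyp n A b → ∀ j k j' k' : Fin n → ℝ, ∀ y z,
      ‖∫ x, (starRingEnd ℂ) (kap ε ψ b j k (x, y)) * kap ε ψ b j' k' (x, z)‖ ≤
        C * A ^ 2 * (gam c p j j' * gam c p k k') ^ 2 := by
  obtain ⟨ρ, Co, hρ, hCo, hosc⟩ := osc n C₀ Q hC₀ hQ
  set ε : ℝ := ρ / (n + 1) with hεd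
  have hε : 0 < ε := by positivity
  have hnε : n * ε ≤ ρ := by
    rw [hεd, ← mul_div_assoc, div_le_iff₀ (by positivity)]
    nlinarith
  obtain ⟨K, hK1, hK⟩ := chi_bd n (2 * n + 1) hε
  have hK0 : 0 ≤ K := by linarith
  set P : ℝ := 2 ^ (2 * n + 1) with hP
  have hP1 : 1 ≤ P := one_le_pow₀ (by norm_num)
  set c : ℝ := 3 + 1 / ε with hc
  have hc0 : 0 ≤ c := by positivity
  have hc3 : 3 ≤ c := by rw [hc]; linarith [show 0 < 1 / ε by positivity]
  set W₀ : ℝ := P * ((P * (K * K)) * (P * (1 * 1))) with hW₀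
  have hW₀1 : 1 ≤ W₀ := by
    have h1 : 1 ≤ K * K := by nlinarith
    have h2 : 1 ≤ P * (K * K) := by nlinarith
    have h3 : 1 ≤ P * (1 * 1) := by linarith
    have h4 : 1 ≤ (P * (K * K)) * (P * (1 * 1)) := by nlinarith
    rw [hW₀]; nlinarith
  refine ⟨ε, c, Co * W₀, hε, hc0, by positivity, ?_⟩
  intro ψ hψ A b hb j k j' k' y z
  have hA := hb.nonneg
  have hG0 : 0 ≤ Co * W₀ * A ^ 2 * (gam c p j j' * gam c p k k') ^ 2 := by positivity
  set w : Eu n → ℂ := fun x => (((chi ε j x : ℝ) : ℂ) * ((chi ε j' x : ℝ) : ℂ)) *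
    ((starRingEnd ℂ) (b (x, y)) * b (x, z)) with hw
  have e : ∫ x, (starRingEnd ℂ) (kap ε ψ b j k (x, y)) * kap ε ψ b j' k' (x, z) =
      (((chi ε k y : ℝ) : ℂ) * ((chi ε k' z : ℝ) : ℂ)) *
      ∫ x, w x * Complex.exp (Complex.I * ((ψ (x, z) - ψ (x, y) : ℝ) : ℂ)) := by
    rw [← integral_const_mul]
    refine integral_congr_ae (Filter.Eventually.of_forall fun x => ?_)
    simp only [kap, hw, map_mul, Complex.conj_ofReal, ← Complex.exp_conj, Complex.conj_I]
    have : Complex.exp (Complex.I * ((ψ (x, z) - ψ (x, y) : ℝ) : ℂ)) =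
        Complex.exp (-Complex.I * (ψ (x, y) : ℂ)) * Complex.exp (Complex.I * (ψ (x, z) : ℂ)) := by
      rw [← Complex.exp_add]
      congr 1
      push_cast
      ring
    rw [this]
    ring
  rw [e]
  by_cases hy : chi ε k y = 0
  · simpa [hy] using hG0
  by_cases hz : chi ε k' z = 0
  · simpa [hz] using hG0
  by_cases hjj : ∃ x, chi ε j x ≠ 0 ∧ chi ε j' x ≠ 0
  swap
  · have hw0 : ∀ x, w x = 0 := by
      intro x
      by_cases h1 : chi ε j x = 0
      · simp [hw, h1]
      · have h2 : chi ε j' x = 0 := by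
          by_contra h2
          exact hjj ⟨x, h1, h2⟩
        simp [hw, h2]
    simpa [hw0] using hG0
  obtain ⟨x₁, hx1, hx2⟩ := hjj
  have hgj : 1 ≤ gam c p j j' := by
    refine one_le_gam hp _ _ fun i => ?_
    have h1 := abs_le.1 (chi_coord hx1 i)
    have h2 := abs_le.1 (chi_coord hx2 i)
    have : |j i - j' i| ≤ 2 := by rw [abs_le]; constructor <;> linarith
    linarith
  have hgk : ((1 + ‖z - y‖)⁻¹) ^ (2 * n + 1) ≤ gam c p k k' ^ 2 := by
    refine decay_le_gam hp hpn (norm_nonneg _) _ _ fun i => ?_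
    have h1 := abs_le.1 (chi_coord hy i)
    have h2 := abs_le.1 (chi_coord hz i)
    have h3 := abs_le.1 (coord_le_norm (z - y) i)
    have h4 : (z - y) i = ε * (z i / ε - y i / ε) := by
      simp
      field_simp
    have h5 : |z i / ε - y i / ε| ≤ ‖z - y‖ / ε := by
      rw [le_div_iff₀ hε, mul_comm, ← abs_of_pos hε, ← abs_mul, abs_of_pos hε, ← h4]
      exact coord_le_norm (z - y) i
    have h6 := abs_le.1 h5
    have h7 : |k i - k' i| ≤ 2 + ‖z - y‖ / ε := by rw [abs_le]; constructor <;> linarith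
    have h8 : c * (1 + ‖z - y‖) = 3 + 3 * ‖z - y‖ + 1 / ε + ‖z - y‖ / ε := by
      rw [hc]; ring
    have h9 : 0 < 1 / ε := by positivity
    have := norm_nonneg (z - y)
    linarith
  -- the amplitude
  have s1 : ∀ q, ContDiff ℝ (⊤ : ℕ∞) (fun x : Eu n => ((chi ε q x : ℝ) : ℂ)) := fun q =>
    Complex.ofRealCLM.contDiff.comp (chi_smooth ε q)
  have s2 : ContDiff ℝ (⊤ : ℕ∞) (fun x : Eu n => (starRingEnd ℂ) (b (x, y))) :=
    (Complex.conjCLE : ℂ →L[ℝ] ℂ).contDiff.comp (slice_smoothX hb.smooth y)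
  have s3 : ContDiff ℝ (⊤ : ℕ∞) (fun x : Eu n => b (x, z)) := slice_smoothX hb.smooth z
  have hws : ContDiff ℝ (⊤ : ℕ∞) w := ((s1 j).mul (s1 j')).mul (s2.mul s3)
  have hwB : ∀ r, Bd (EuclideanSpace.single r (1 : ℝ)) Set.univ (2 * n + 1) (W₀ * A ^ 2) w := by
    intro r
    have b1 := Bd.mul isOpen_univ hK0 hK0 (s1 j).contDiffOn (s1 j').contDiffOn (hK j r) (hK j' r)
    have c2 : Bd (EuclideanSpace.single r (1 : ℝ)) Set.univ (2 * n + 1) A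
        (fun x : Eu n => (starRingEnd ℂ) (b (x, y))) := by
      refine Bd.of_iterate fun m hm x _ => ?_
      rw [iter_conj _ m (slice_smoothX hb.smooth y), RCLike.norm_conj, iter_sliceX r y m hb.smooth]
      exact hb.bX r m hm _
    have c3 : Bd (EuclideanSpace.single r (1 : ℝ)) Set.univ (2 * n + 1) A
        (fun x : Eu n => b (x, z)) := by
      refine Bd.of_iterate fun m hm x _ => ?_
      rw [iter_sliceX r z m hb.smooth]
      exact hb.bX r m hm _
    have b2 := Bd.mul isOpen_univ hA hA s2.contDiffOn s3.contDiffOn c2 c3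
    have b3 := Bd.mul isOpen_univ (by positivity) (by positivity)
      ((s1 j).mul (s1 j')).contDiffOn (s2.mul s3).contDiffOn b1 b2
    refine b3.mono_const (le_of_eq ?_)
    rw [hW₀, hP]
    ring
  have hchin : ∀ q x, ‖((chi ε q x : ℝ) : ℂ)‖ ≤ 1 := fun q (x : Eu n) => by
    rw [Complex.norm_real, Real.norm_of_nonneg (chi_nonneg _ _ _)]
    exact chi_le_one _ _ _
  have hwn : ∀ x, ‖w x‖ ≤ W₀ * A ^ 2 := by
    intro x
    simp only [hw, norm_mul, RCLike.norm_conj]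
    calc _ ≤ (1 * 1) * (A * A) := by
          gcongr
          · exact hchin _ _
          · exact hchin _ _
          · exact hb.b0 _
          · exact hb.b0 _
      _ = 1 * A ^ 2 := by ring
      _ ≤ _ := by gcongr
  have hsupp : tsupport w ⊆ Metric.closedBall (cen ε j) ρ := by
    refine closure_minimal ?_ Metric.isClosed_closedBall
    intro x hx
    refine Metric.closedBall_subset_closedBall hnε (chi_ball hε fun h0 => hx ?_)
    simp [hw, h0]
  have key := hosc ψ hψ (cen ε j) w (W₀ * A ^ 2) (by positivity) hws hsupp hwn hwB y z
  rw [norm_mul, norm_mul]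
  calc _ ≤ (1 * 1) * (Co * (W₀ * A ^ 2) * ((1 + ‖z - y‖)⁻¹) ^ (2 * n + 1)) := by
        gcongr
        · exact hchin _ _
        · exact hchin _ _
    _ ≤ (1 * 1) * (Co * (W₀ * A ^ 2) * (1 ^ 2 * gam c p k k' ^ 2)) := by
        gcongr; linarith
    _ ≤ (1 * 1) * (Co * (W₀ * A ^ 2) * (gam c p j j' ^ 2 * gam c p k k' ^ 2)) := by gcongr
    _ = _ := by ring

end Assembly


section Main

theorem gam_sum {n : ℕ} {c p Γ : ℝ} (hc : 0 ≤ c) (hΓ : ∀ (M : ℕ) (m' : Fin (2 * M + 1)),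
      ∑ m : Fin (2 * M + 1), (c / (1 + |((m : ℕ) : ℝ) - ((m' : ℕ) : ℝ)|)) ^ p ≤ Γ)
    (M : ℕ) (k' : Fin n → Fin (2 * M + 1)) :
    ∑ k : Fin n → Fin (2 * M + 1), gam c p (grid M k) (grid M k') ≤ Γ ^ n := by
  unfold gam grid
  rw [sum_pi_prod (fun i (m : Fin (2 * M + 1)) =>
    (c / (1 + |((m : ℕ) : ℝ) - M - (((k' i : ℕ) : ℝ) - M)|)) ^ p)]
  calc _ ≤ ∏ i : Fin n, Γ := by
        refine Finset.prod_le_prod (fun i _ => Finset.sum_nonneg fun m _ => by positivity) ?_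
        intro i _
        simpa using hΓ M (k' i)
    _ = Γ ^ n := by simp

theorem main_bound (n : ℕ) (C₀ Q : ℝ) (hC₀ : 0 < C₀) (hQ : 0 < Q) : ∃ C : ℝ, 0 < C ∧
    ∀ ψ, PhaseHyp n C₀ Q ψ → ∀ A b, SymHyp n A b → ∀ f : Eu n → ℂ, MemLp f 2 → Integrable f →
      eLpNorm (fun x => ∫ y, Complex.exp (Complex.I * (ψ (x, y) : ℂ)) * b (x, y) * f y) 2 volume ≤
        ENNReal.ofReal (C * A) * eLpNorm f 2 volume := by
  set p : ℝ := 1 + 1 / (2 * n + 1) with hpd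
  have hp1 : 1 < p := by
    rw [hpd]
    have : (0 : ℝ) < 1 / (2 * n + 1) := by positivity
    linarith
  have hpn : 2 * n * p ≤ 2 * n + 1 := by
    have : (2 * n : ℝ) * (1 / (2 * n + 1)) ≤ 1 := by
      rw [mul_one_div, div_le_one (by positivity)]; linarith
    rw [hpd]; linarith
  obtain ⟨ε, c, C₁, hε, hc, hC₁, hkap⟩ := kap_bound n C₀ Q hC₀ hQ p (by linarith) hpn
  obtain ⟨Γ, hΓ0, hΓ⟩ := grid_sum c p hc hp1
  set V : ℝ := (volume : Measure (Eu n)).real (Metric.closedBall 0 (n * ε)) with hV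
  have hV0 : 0 ≤ V := measureReal_nonneg
  have hVx : ∀ x : Eu n, (volume : Measure (Eu n)).real (Metric.closedBall x (n * ε)) = V := by
    intro x
    rw [hV, Measure.real, Measure.real, Measure.addHaar_closedBall_center]
  refine ⟨√(V * C₁) * (Γ ^ n * Γ ^ n) + 1, by positivity, ?_⟩
  intro ψ hψ A b hb f hf hfi
  have hA := hb.nonneg
  have hψc := hψ.smooth.continuous
  have hbc := hb.smooth.continuous
  -- the localized bound
  have step : ∀ M : ℕ, eLpNorm (fun x => ∫ y,
      (∑ i : (Fin n → Fin (2 * M + 1)) × (Fin n → Fin (2 * M + 1)),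
        kap ε ψ b (grid M i.1) (grid M i.2) (x, y)) * f y) 2 volume ≤
      ENNReal.ofReal ((√(V * C₁) * (Γ ^ n * Γ ^ n) + 1) * A) * eLpNorm f 2 volume := by
    intro M
    let D : (Fin n → Fin (2 * M + 1)) × (Fin n → Fin (2 * M + 1)) →
      (Fin n → Fin (2 * M + 1)) × (Fin n → Fin (2 * M + 1)) → ℝ := fun i i' =>
      C₁ * A ^ 2 * (gam c p (grid M i.1) (grid M i'.1) * gam c p (grid M i.2) (grid M i'.2)) ^ 2
    have hsum : ∀ i', ∑ i, √(V * D i i') ≤ (√(V * C₁) * (Γ ^ n * Γ ^ n) + 1) * A := by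
      intro i'
      have e : ∀ i, √(V * D i i') = √(V * C₁) * A *
          (gam c p (grid M i.1) (grid M i'.1) * gam c p (grid M i.2) (grid M i'.2)) := by
        intro i
        have g1 := gam_nonneg (p := p) hc (grid M i.1) (grid M i'.1)
        have g2 := gam_nonneg (p := p) hc (grid M i.2) (grid M i'.2)
        have : V * D i i' = (V * C₁) * (A *
          (gam c p (grid M i.1) (grid M i'.1) * gam c p (grid M i.2) (grid M i'.2))) ^ 2 := by
          simp only [D]; ring
        rw [this, Real.sqrt_mul (by positivity), Real.sqrt_sq (by positivity), mul_assoc]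
      rw [Finset.sum_congr rfl fun i _ => e i, ← Finset.mul_sum, Fintype.sum_prod_type]
      simp only
      rw [← Finset.sum_mul_sum]
      have k1 := gam_sum hc hΓ M i'.1
      have k2 := gam_sum hc hΓ M i'.2
      have k3 : 0 ≤ ∑ k : Fin n → Fin (2 * M + 1), gam c p (grid M k) (grid M i'.2) :=
        Finset.sum_nonneg fun k _ => gam_nonneg hc _ _
      calc _ ≤ √(V * C₁) * A * (Γ ^ n * Γ ^ n) := by gcongr
        _ ≤ _ := by nlinarith
    refine op_sum_bound (fun i : (Fin n → Fin (2 * M + 1)) × (Fin n → Fin (2 * M + 1)) =>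
      kap ε ψ b (grid M i.1) (grid M i.2)) _ _ (fun i => kap_isKer hε hψc hbc _ _) V
      (fun i => (hVx _).le) (fun i => (hVx _).le) D D ?_ ?_ _ (by positivity) hsum hsum hf
    · intro i i' y z
      exact hkap ψ hψ A b hb _ _ _ _ y z
    · intro i i' y z
      have h1 := hkap _ hψ.swap A _ hb.swap (grid M i.2) (grid M i.1) (grid M i'.2) (grid M i'.1) y z
      have e : ∀ (j k : Fin n → ℝ) (x y : Eu n), kap ε (fun z => ψ z.swap) (fun z => b z.swap) k j
          (x, y) = kap ε ψ b j k (y, x) := by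
        intro j k x y
        simp only [kap, Prod.swap]
        ring
      simp only [e] at h1
      have h2 : ∫ x, kap ε ψ b (grid M i.1) (grid M i.2) (y, x) *
          (starRingEnd ℂ) (kap ε ψ b (grid M i'.1) (grid M i'.2) (z, x)) = (starRingEnd ℂ)
          (∫ x, (starRingEnd ℂ) (kap ε ψ b (grid M i.1) (grid M i.2) (y, x)) *
            kap ε ψ b (grid M i'.1) (grid M i'.2) (z, x)) := by
        rw [← integral_conj]
        simp
      rw [h2, RCLike.norm_conj]
      refine h1.trans (le_of_eq ?_)
      simp only [D]
      ring
  -- the sum of the kernels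
  have hker : ∀ (M : ℕ) (x y : Eu n),
      ∑ i : (Fin n → Fin (2 * M + 1)) × (Fin n → Fin (2 * M + 1)),
        kap ε ψ b (grid M i.1) (grid M i.2) (x, y) =
      ((theta ε M x : ℝ) : ℂ) * ((theta ε M y : ℝ) : ℂ) *
        (Complex.exp (Complex.I * (ψ (x, y) : ℂ)) * b (x, y)) := by
    intro M x y
    simp only [kap]
    rw [← Finset.sum_mul, Fintype.sum_prod_type, ← chi_sum, ← chi_sum]
    push_cast
    rw [Finset.sum_mul_sum]
  have hlim : ∀ x, Filter.Tendsto (fun M : ℕ => ∫ y,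
      (∑ i : (Fin n → Fin (2 * M + 1)) × (Fin n → Fin (2 * M + 1)),
        kap ε ψ b (grid M i.1) (grid M i.2) (x, y)) * f y) Filter.atTop
      (nhds (∫ y, Complex.exp (Complex.I * (ψ (x, y) : ℂ)) * b (x, y) * f y)) := by
    intro x
    refine tendsto_integral_of_dominated_convergence (fun y => A * ‖f y‖) ?_
      (hfi.norm.const_mul A) ?_ ?_
    · intro M
      refine AEStronglyMeasurable.mul (Continuous.aestronglyMeasurable ?_) hf.1
      refine continuous_finsetSum _ fun i _ => ?_
      exact (kap_smooth hψc hbc _ _).comp (by fun_prop)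
    · intro M
      refine Filter.Eventually.of_forall fun y => ?_
      rw [hker, norm_mul, norm_mul, norm_mul, norm_mul, Complex.norm_real, Complex.norm_real,
        mul_comm Complex.I, Complex.norm_exp_ofReal_mul_I]
      have t1 := theta_abs ε M x
      have t2 := theta_abs ε M y
      have t3 := hb.b0 (x, y)
      calc _ ≤ 1 * 1 * (1 * A) * ‖f y‖ := by
            gcongr
            · exact t1
            · exact t2
        _ = _ := by ring
    · refine Filter.Eventually.of_forall fun y => ?_
      refine tendsto_const_nhds.congr' ?_
      filter_upwards [theta_tendsto ε x, theta_tendsto ε y] with M h1 h2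
      rw [hker, h1, h2]
      simp
  refine (Lp.eLpNorm_lim_le_liminf_eLpNorm (f := fun M x => ∫ y,
      (∑ i : (Fin n → Fin (2 * M + 1)) × (Fin n → Fin (2 * M + 1)),
        kap ε ψ b (grid M i.1) (grid M i.2) (x, y)) * f y) ?_ _
      (Filter.Eventually.of_forall hlim)).trans ?_
  · intro M
    refine IsKer.aesm (κ := fun z => ∑ i : (Fin n → Fin (2 * M + 1)) × (Fin n → Fin (2 * M + 1)),
        kap ε ψ b (grid M i.1) (grid M i.2) z) ?_ hf.1
    exact continuous_finsetSum _ fun i _ => kap_smooth hψc hbc _ _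
  · refine (Filter.liminf_le_liminf (Filter.Eventually.of_forall step)).trans ?_
    simp

theorem foldr_single {α : Type*} : ∀ {n : ℕ} (F : Fin n → α → α) (r : Fin n),
    (∀ i, i ≠ r → F i = id) → (List.ofFn F).foldr (· ∘ ·) id = F r := by
  have hid : ∀ {n : ℕ} (F : Fin n → α → α), (∀ i, F i = id) →
      (List.ofFn F).foldr (· ∘ ·) id = id := by
    intro n
    induction n with
    | zero => intro F _; simp
    | succ n ih =>
      intro F h
      rw [List.ofFn_succ, List.foldr_cons, ih _ fun i => h _, h 0]
      rfl
  intro n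
  induction n with
  | zero => intro F r; exact r.elim0
  | succ n ih =>
    intro F r h
    rw [List.ofFn_succ, List.foldr_cons]
    refine Fin.cases (fun h => ?_) (fun r h => ?_) r h
    · rw [hid _ fun i => h _ (Fin.succ_ne_zero i)]
      rfl
    · rw [ih (fun i => F i.succ) r fun i hi => h _ (by simpa using hi),
        h 0 (Fin.succ_ne_zero r).symm]
      rfl

theorem mderiv_single {n : ℕ} {W F : Type*} [NormedAddCommGroup W] [NormedSpace ℝ W]
    [NormedAddCommGroup F] [NormedSpace ℝ F] (dirs : Fin n → W) (r : Fin n) (m : ℕ) (g : W → F) :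
    mderiv dirs (Pi.single r m) g = (dLine (dirs r))^[m] g := by
  unfold mderiv
  rw [foldr_single _ r]
  · simp
  · intro i hi
    simp [hi]

theorem mderiv_zero {n : ℕ} {W F : Type*} [NormedAddCommGroup W] [NormedSpace ℝ W]
    [NormedAddCommGroup F] [NormedSpace ℝ F] (dirs : Fin n → W) (g : W → F) :
    mderiv dirs 0 g = g := by
  rcases Nat.eq_zero_or_pos n with rfl | hn
  · simp [mderiv]
  · have := mderiv_single dirs ⟨0, hn⟩ 0 g
    simpa using this

theorem mdeg_single {n : ℕ} (r : Fin n) (m : ℕ) : mdeg (Pi.single r m) = m := by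
  simp [mdeg]

theorem iter_const {W F : Type*} [NormedAddCommGroup W] [NormedSpace ℝ W]
    [NormedAddCommGroup F] [NormedSpace ℝ F] (v : W) (c : F) (m : ℕ) (z : W) :
    ‖(dLine v)^[m] (fun _ => c) z‖ ≤ ‖c‖ := by
  have h0 : dLine v (fun _ : W => (0 : F)) = fun _ => 0 := by ext z; simp [dLine]
  have h1 : ∀ m, (dLine v)^[m] (fun _ : W => (0 : F)) = fun _ => 0 := by
    intro m
    induction m with
    | zero => rfl
    | succ m ih => rw [Function.iterate_succ_apply, h0, ih]
  cases m with
  | zero => exact le_rfl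
  | succ m =>
    have h2 : dLine v (fun _ : W => c) = fun _ => 0 := by ext z; simp [dLine]
    rw [Function.iterate_succ_apply, h2, h1]
    simp

theorem phase_inner (n : ℕ) : PhaseHyp n 1 1 (fun z => ⟪z.1, z.2⟫) := by
  have h1 : ∀ j : Fin n, dLine (dY j) (fun z : Eu n × Eu n => (⟪z.1, z.2⟫ : ℝ)) = fun z => z.1 j := by
    intro j
    ext z
    change fderiv ℝ (fun z : Eu n × Eu n => (⟪z.1, z.2⟫ : ℝ)) z _ = _
    rw [fderiv_inner_apply (𝕜 := ℝ) differentiableAt_fst differentiableAt_snd]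
    simp [dY, fderiv_fst, fderiv_snd, EuclideanSpace.inner_single_right]
  have h2 : ∀ i j : Fin n, mixedHessXY (fun z : Eu n × Eu n => (⟪z.1, z.2⟫ : ℝ)) i j =
      fun _ => if i = j then 1 else 0 := by
    intro i j
    unfold mixedHessXY
    rw [h1]
    ext z
    have h3 : HasFDerivAt (fun z : Eu n × Eu n => z.1 j)
        ((EuclideanSpace.proj (𝕜 := ℝ) j).comp (ContinuousLinearMap.fst ℝ (Eu n) (Eu n))) z :=
      ((EuclideanSpace.proj (𝕜 := ℝ) j).comp
        (ContinuousLinearMap.fst ℝ (Eu n) (Eu n))).hasFDerivAt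
    change fderiv ℝ (fun z : Eu n × Eu n => z.1 j) z _ = _
    rw [h3.fderiv]
    simp [dX, Pi.single_apply, eq_comm]
  have h4 : ∀ i j : Fin n, ‖(if i = j then 1 else 0 : ℝ)‖ ≤ 1 := by
    intro i j; split_ifs <;> simp
  refine ⟨contDiff_fst.inner ℝ contDiff_snd, ?_, ?_, ?_⟩
  · intro z
    have : (Matrix.of fun i j => mixedHessXY (fun z : Eu n × Eu n => (⟪z.1, z.2⟫ : ℝ)) i j z) = 1 := by
      ext i j
      simp [h2, Matrix.one_apply]
    rw [this]
    simp
  · intro i l r m _ z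
    rw [h2]
    exact (iter_const _ _ m z).trans (h4 i l)
  · intro i l r m _ z
    rw [h2]
    exact (iter_const _ _ m z).trans (h4 i l)

end Main

/-- `L²`-boundedness of `Tu(x) = ∫∫ e^{i(x·ξ+φ(y,ξ))} a(x,ξ) u(y) dy dξ`
for amplitudes in the class `S⁰₀,₀` vanishing for `ξ` outside a compact set `K`;
the constant depends only on `n`, `C₀`, the phase constants and finitely many of the
symbol constants (hence the bound `C * A` where `A` controls derivatives of order `≤ N`),
and is independent of `K`. -/
theorem statement3 (n : ℕ) (C₀ : ℝ) (hC₀ : 0 < C₀) (Cph : (Fin n → ℕ) → ℝ) :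
    ∃ (N : ℕ) (C : ℝ), 0 < C ∧
      ∀ (φ : EuclideanSpace ℝ (Fin n) × EuclideanSpace ℝ (Fin n) → ℝ)
        (a : EuclideanSpace ℝ (Fin n) × EuclideanSpace ℝ (Fin n) → ℂ)
        (K : Set (EuclideanSpace ℝ (Fin n))), IsCompact K →
        ContDiff ℝ (⊤ : ℕ∞) φ → ContDiff ℝ (⊤ : ℕ∞) a →
        -- nondegeneracy of the mixed Hessian `∂_y∂_ξ φ`:
        (∀ z, C₀ ≤ |Matrix.det (Matrix.of fun i j => mixedHessXY φ i j z)|) →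
        -- bounded derivatives of the entries of `∂_y∂_ξ φ`:
        (∀ i j : Fin n, ∀ α : Fin n → ℕ, mdeg α ≤ 2 * n + 1 →
          (∀ z, |mderiv dX α (mixedHessXY φ i j) z| ≤ Cph α) ∧
          (∀ z, |mderiv dY α (mixedHessXY φ i j) z| ≤ Cph α)) →
        -- `a` vanishes for `ξ` outside the compact set `K`:
        (∀ x ξ, ξ ∉ K → a (x, ξ) = 0) →
        -- `a ∈ S⁰₀,₀` : all derivatives are bounded:
        (∀ α β : Fin n → ℕ, ∃ Cab : ℝ, ∀ z, ‖mderiv dX α (mderiv dY β a) z‖ ≤ Cab) →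
        ∀ A : ℝ,
        (∀ α β : Fin n → ℕ, mdeg α ≤ N → mdeg β ≤ N →
          ∀ z, ‖mderiv dX α (mderiv dY β a) z‖ ≤ A) →
        ∀ u : 𝓢(EuclideanSpace ℝ (Fin n), ℂ),
          eLpNorm (fun x => ∫ ξ, ∫ y,
              Complex.exp (Complex.I * ((⟪x, ξ⟫ + φ (y, ξ) : ℝ) : ℂ)) * a (x, ξ) * u y)
              2 volume
            ≤ ENNReal.ofReal (C * A) * eLpNorm (⇑u) 2 volume := by
  set Q : ℝ := 1 + ∑ r : Fin n, ∑ m ∈ Finset.range (2 * n + 2), |Cph (Pi.single r m)| with hQdef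
  have hS0 : 0 ≤ ∑ r : Fin n, ∑ m ∈ Finset.range (2 * n + 2), |Cph (Pi.single r m)| :=
    Finset.sum_nonneg fun r _ => Finset.sum_nonneg fun m _ => abs_nonneg _
  have hQ : 0 < Q := by linarith
  have hCQ : ∀ (r : Fin n) (m : ℕ), m ≤ 2 * n + 1 → Cph (Pi.single r m) ≤ Q := by
    intro r m hm
    have h1 : |Cph (Pi.single r m)| ≤
        ∑ m ∈ Finset.range (2 * n + 2), |Cph (Pi.single r m)| :=
      Finset.single_le_sum (f := fun m => |Cph (Pi.single r m)|)
        (fun _ _ => abs_nonneg _) (Finset.mem_range.2 (by omega))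
    have h2 : ∑ m ∈ Finset.range (2 * n + 2), |Cph (Pi.single r m)| ≤
        ∑ r : Fin n, ∑ m ∈ Finset.range (2 * n + 2), |Cph (Pi.single r m)| :=
      Finset.single_le_sum
        (f := fun r : Fin n => ∑ m ∈ Finset.range (2 * n + 2), |Cph (Pi.single r m)|)
        (fun _ _ => Finset.sum_nonneg fun m _ => abs_nonneg _) (Finset.mem_univ r)
    have h3 := le_abs_self (Cph (Pi.single r m))
    linarith
  obtain ⟨C1, hC1, H1⟩ := main_bound n C₀ Q hC₀ hQ
  obtain ⟨C2, hC2, H2⟩ := main_bound n 1 1 one_pos one_pos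
  refine ⟨2 * n + 1, C2 * C1, mul_pos hC2 hC1, ?_⟩
  intro φ a K hK hφs has hdet hder haK _ A hA u
  have hφ : PhaseHyp n C₀ Q φ := by
    refine ⟨hφs, hdet, ?_, ?_⟩
    · intro i l r m hm z
      rw [← mderiv_single]
      exact ((hder i l _ (by rw [mdeg_single]; exact hm)).1 z).trans (hCQ r m hm)
    · intro i l r m hm z
      rw [← mderiv_single]
      exact ((hder i l _ (by rw [mdeg_single]; exact hm)).2 z).trans (hCQ r m hm)
  have hz0 : mdeg (0 : Fin n → ℕ) ≤ 2 * n + 1 := by simp [mdeg]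
  have ha : SymHyp n A a := by
    refine ⟨has, ?_, ?_, ?_⟩
    · intro z
      have := hA 0 0 hz0 hz0 z
      rwa [mderiv_zero, mderiv_zero] at this
    · intro r m hm z
      have := hA (Pi.single r m) 0 (by rw [mdeg_single]; exact hm) hz0 z
      rwa [mderiv_zero, mderiv_single] at this
    · intro r m hm z
      have := hA 0 (Pi.single r m) hz0 (by rw [mdeg_single]; exact hm) z
      rwa [mderiv_zero, mderiv_single] at this
  have h1 : SymHyp n 1 (fun _ => (1 : ℂ)) := by
    refine ⟨contDiff_const, fun z => by simp, ?_, ?_⟩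
    · intro r m _ z
      exact (iter_const _ (1 : ℂ) m z).trans (by simp)
    · intro r m _ z
      exact (iter_const _ (1 : ℂ) m z).trans (by simp)
  have hu2 : MemLp (⇑u) 2 volume := u.memLp 2 volume
  have hu1 : Integrable (⇑u) volume := u.integrable
  set S : Eu n → ℂ := fun ξ => ∫ y, Complex.exp (Complex.I * (φ (y, ξ) : ℂ)) * 1 * u y with hS
  have hSb : eLpNorm S 2 volume ≤ ENNReal.ofReal (C1 * 1) * eLpNorm (⇑u) 2 volume :=
    H1 _ hφ.swap 1 _ h1 _ hu2 hu1
  have hSm : AEStronglyMeasurable S volume := by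
    have hc : Continuous φ := hφs.continuous
    exact IsKer.aesm
      (κ := fun z : Eu n × Eu n => Complex.exp (Complex.I * (φ (z.2, z.1) : ℂ)) * 1)
      (by fun_prop) hu2.1
  have hS2 : MemLp S 2 volume :=
    ⟨hSm, hSb.trans_lt (ENNReal.mul_lt_top ENNReal.ofReal_lt_top hu2.2)⟩
  have hv2 : MemLp (K.indicator S) 2 volume := hS2.indicator hK.measurableSet
  have hv1 : Integrable (K.indicator S) volume := by
    have hfin : IsFiniteMeasure (volume.restrict K) := ⟨by
      rw [Measure.restrict_apply_univ]; exact hK.measure_lt_top⟩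
    have h1 : MemLp S 1 (volume.restrict K) := (hS2.restrict K).mono_exponent (by norm_num)
    exact (integrable_indicator_iff hK.measurableSet).2 (memLp_one_iff_integrable.1 h1)
  have hT : (fun x => ∫ ξ, ∫ y,
      Complex.exp (Complex.I * ((⟪x, ξ⟫ + φ (y, ξ) : ℝ) : ℂ)) * a (x, ξ) * u y) =
      fun x : Eu n => ∫ ξ, Complex.exp (Complex.I * ((⟪x, ξ⟫ : ℝ) : ℂ)) * a (x, ξ) *
        K.indicator S ξ := by
    funext x
    congr 1
    funext ξ
    by_cases hξ : ξ ∈ K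
    · rw [Set.indicator_of_mem hξ, hS]
      simp only
      rw [← integral_const_mul]
      congr 1
      funext y
      push_cast
      rw [mul_add, Complex.exp_add]
      ring
    · simp [haK x ξ hξ]
  rw [hT]
  have hA0 : 0 ≤ A := ha.nonneg
  refine (H2 _ (phase_inner n) A a ha _ hv2 hv1).trans ?_
  calc ENNReal.ofReal (C2 * A) * eLpNorm (K.indicator S) 2 volume
      ≤ ENNReal.ofReal (C2 * A) * (ENNReal.ofReal (C1 * 1) * eLpNorm (⇑u) 2 volume) := by
        gcongr
        exact (eLpNorm_indicator_le _).trans hSb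
    _ = ENNReal.ofReal (C2 * C1 * A) * eLpNorm (⇑u) 2 volume := by
        rw [← mul_assoc, ← ENNReal.ofReal_mul (by positivity)]
        congr 2
        ring
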